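/- arXiv:2112.01448 — 8 statements merged into one kernel-verified Lean document; each statement's English description precedes it below -/
import Mathlib

section
/- Let n ≥ 2 and α_n = n/ω_{n−1}. Let T₁S^n = {(x,v) ∈ S^n × S^n : ⟨x,v⟩ = 0} and let Ψ : T₁S^n → ℝ be continuous with Ψ(x,−v) = −Ψ(x,v) for all (x,v). Then there exists a unique pair (φ, X), where φ : T₁S^n → ℝ and X : S^n → ℝ^{n+1} with ⟨X(v),v⟩ = 0 for all v, such that: (a) Ψ(x,v) = φ(x,v) + α_n·⟨X(v),x⟩ for all (x,v) ∈ T₁S^n, and (b) for every v ∈ S^n and every u ∈ ℝ^{n+1} with ⟨u,v⟩ = 0, ∫_{Σ_v} φ(x,v)·⟨x,u⟩ dσ_v(x) = 0. Moreover φ and X are continuous, φ(x,−v) = −φ(x,v), and X(−v) = −X(v). -/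
open MeasureTheory
open scoped RealInnerProductSpace

/-- The canonical surface measure on the unit sphere of `ℝ^n`. -/
noncomputable def sphereMeasure (n : ℕ) :
    Measure (Metric.sphere (0 : EuclideanSpace ℝ (Fin n)) 1) :=
  (volume : Measure (EuclideanSpace ℝ (Fin n))).toSphere

/-- `ω k`: the total surface measure of the unit sphere `S^k ⊂ ℝ^{k+1}`. -/
noncomputable def sphereArea (k : ℕ) : ℝ :=
  (sphereMeasure (k + 1) Set.univ).toReal

/-- The unit tangent bundle `T₁S^n = {(x,v) ∈ S^n × S^n : ⟨x,v⟩ = 0}`, as a subset of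
`ℝ^{n+1} × ℝ^{n+1}`. -/
def T1Set (n : ℕ) :
    Set (EuclideanSpace ℝ (Fin (n + 1)) × EuclideanSpace ℝ (Fin (n + 1))) :=
  {p | ‖p.1‖ = 1 ∧ ‖p.2‖ = 1 ∧ ⟪p.1, p.2⟫ = 0}

/-- The decomposition `Ψ(x,v) = φ(x,v) + α_n·⟨X(v),x⟩` of Proposition 3.3 of the paper:
`X(v)` is tangent to `S^n` at `v`, the identity (a) holds on `T₁S^n`, and (b) the
restriction of `φ` to each equator `Σ_v` is orthogonal to the linear functions
`x ↦ ⟨x,u⟩` (integration over `Σ_v` realized through any linear isometry `L` of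
`ℝ^n` onto `v^⊥`). Here `α_n = n/ω_{n−1}`. -/
def IsCenterDecomp (n : ℕ)
    (Ψ φ : EuclideanSpace ℝ (Fin (n + 1)) → EuclideanSpace ℝ (Fin (n + 1)) → ℝ)
    (X : EuclideanSpace ℝ (Fin (n + 1)) → EuclideanSpace ℝ (Fin (n + 1))) : Prop :=
  (∀ v, ‖v‖ = 1 → ⟪X v, v⟫ = 0) ∧
  (∀ x v, (x, v) ∈ T1Set n →
    Ψ x v = φ x v + ((n : ℝ) / sphereArea (n - 1)) * ⟪X v, x⟫) ∧
  (∀ v, ‖v‖ = 1 → ∀ u : EuclideanSpace ℝ (Fin (n + 1)), ⟪u, v⟫ = 0 →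
    ∀ L : EuclideanSpace ℝ (Fin n) →ₗᵢ[ℝ] EuclideanSpace ℝ (Fin (n + 1)),
      LinearMap.range L.toLinearMap = (Submodule.span ℝ {v})ᗮ →
      (∫ y : Metric.sphere (0 : EuclideanSpace ℝ (Fin n)) 1,
          φ (L ↑y) v * ⟪(L ↑y : EuclideanSpace ℝ (Fin (n + 1))), u⟫ ∂(sphereMeasure n)) = 0)

open Metric Submodule Topology Pointwise

local notation "𝔼" n => EuclideanSpace ℝ (Fin n)

/-- The homeomorphism of the unit sphere induced by a linear isometry. -/
def sphereHomeomorph {E : Type*} [NormedAddCommGroup E] [NormedSpace ℝ E] (O : E ≃ₗᵢ[ℝ] E) :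
    sphere (0 : E) 1 ≃ₜ sphere (0 : E) 1 where
  toFun y := ⟨O y, by simp⟩
  invFun y := ⟨O.symm y, by simp⟩
  left_inv y := by ext; simp
  right_inv y := by ext; simp
  continuous_toFun := by fun_prop
  continuous_invFun := by fun_prop

instance isFiniteMeasure_sphereMeasure (n : ℕ) : IsFiniteMeasure (sphereMeasure n) := by
  unfold sphereMeasure; infer_instance

theorem measurePreserving_sphereHomeomorph {n : ℕ} (O : (𝔼 n) ≃ₗᵢ[ℝ] (𝔼 n)) :
    MeasurePreserving (sphereHomeomorph O) (sphereMeasure n) (sphereMeasure n) := by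
  refine ⟨(sphereHomeomorph O).measurable, Measure.ext fun s hs => ?_⟩
  rw [Measure.map_apply (sphereHomeomorph O).measurable hs, sphereMeasure,
    Measure.toSphere_apply' _ ((sphereHomeomorph O).measurable hs), Measure.toSphere_apply' _ hs]
  congr 1
  rw [← O.measurePreserving.measure_preimage_equiv (f := O.toMeasurableEquiv)
    (Set.Ioo (0 : ℝ) 1 • (Set.image Subtype.val s))]
  congr 1
  ext x
  simp only [Set.mem_smul, Set.mem_image, Set.mem_preimage, Subtype.exists, exists_and_right,
    exists_eq_right]
  constructor
  · rintro ⟨r, hr, y, ⟨hy, hys⟩, rfl⟩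
    exact ⟨r, hr, O y, ⟨by simpa using hy, hys⟩, by simp⟩
  · rintro ⟨r, hr, y, ⟨hy, hys⟩, hx⟩
    refine ⟨r, hr, O.symm y, ⟨by simpa using hy, ?_⟩, ?_⟩
    · simpa [sphereHomeomorph] using hys
    · apply O.injective
      simpa using hx

theorem integral_sphere_comp {n : ℕ} {F : Type*} [NormedAddCommGroup F] [NormedSpace ℝ F]
    (O : (𝔼 n) ≃ₗᵢ[ℝ] (𝔼 n)) (f : (𝔼 n) → F) :
    ∫ y : sphere (0 : 𝔼 n) 1, f (O y) ∂(sphereMeasure n) =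
      ∫ y : sphere (0 : 𝔼 n) 1, f y ∂(sphereMeasure n) :=
  (measurePreserving_sphereHomeomorph O).integral_comp
    (sphereHomeomorph O).measurableEmbedding fun y => f y

theorem integrable_sphere {n : ℕ} {F : Type*} [NormedAddCommGroup F]
    {f : sphere (0 : 𝔼 n) 1 → F} (hf : Continuous f) : Integrable f (sphereMeasure n) :=
  hf.integrable_of_hasCompactSupport (HasCompactSupport.of_compactSpace f)

theorem integral_sphere_inner_sq_eq_of_norm_eq {n : ℕ} {a b : 𝔼 n} (h : ‖a‖ = ‖b‖) :
    ∫ y : sphere (0 : 𝔼 n) 1, ⟪a, (y : 𝔼 n)⟫ ^ 2 ∂(sphereMeasure n) =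
      ∫ y : sphere (0 : 𝔼 n) 1, ⟪b, (y : 𝔼 n)⟫ ^ 2 ∂(sphereMeasure n) := by
  rw [← integral_sphere_comp (reflection (ℝ ∙ (a - b))ᗮ) fun y => ⟪b, y⟫ ^ 2]
  congr! 3 with y
  rw [← LinearIsometryEquiv.inner_map_map (reflection (ℝ ∙ (a - b))ᗮ) a, reflection_sub h]

theorem integral_sphere_inner_sq {n : ℕ} (a : 𝔼 n) :
    n * ∫ y : sphere (0 : 𝔼 n) 1, ⟪a, (y : 𝔼 n)⟫ ^ 2 ∂(sphereMeasure n) =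
      (sphereMeasure n).real Set.univ * ‖a‖ ^ 2 := by
  have hi (i : Fin n) : ∫ y : sphere (0 : 𝔼 n) 1, ⟪a, (y : 𝔼 n)⟫ ^ 2 ∂(sphereMeasure n) =
      ∫ y : sphere (0 : 𝔼 n) 1, ‖a‖ ^ 2 * (y : 𝔼 n) i ^ 2 ∂(sphereMeasure n) := by
    rw [integral_sphere_inner_sq_eq_of_norm_eq (b := ‖a‖ • EuclideanSpace.single i 1)
      (by simp [norm_smul])]
    simp [inner_smul_left, mul_pow, EuclideanSpace.inner_single_left]
  calc
    _ = ∑ i : Fin n, ∫ y : sphere (0 : 𝔼 n) 1,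
        ‖a‖ ^ 2 * (y : 𝔼 n) i ^ 2 ∂(sphereMeasure n) := by simp [← hi]
    _ = ∫ y : sphere (0 : 𝔼 n) 1, ‖a‖ ^ 2 ∂(sphereMeasure n) := by
      rw [← integral_finsetSum _ fun i _ => integrable_sphere (by fun_prop)]
      simp [← Finset.mul_sum, ← EuclideanSpace.real_norm_sq_eq]
    _ = _ := by simp

theorem integral_sphere_inner_mul_inner {n : ℕ} (a b : 𝔼 n) :
    n * ∫ y : sphere (0 : 𝔼 n) 1, ⟪a, (y : 𝔼 n)⟫ * ⟪b, (y : 𝔼 n)⟫ ∂(sphereMeasure n) =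
      (sphereMeasure n).real Set.univ * ⟪a, b⟫ := by
  have hp (y : 𝔼 n) : ⟪a, y⟫ * ⟪b, y⟫ = (⟪a + b, y⟫ ^ 2 - ⟪a - b, y⟫ ^ 2) / 4 := by
    rw [inner_add_left, inner_sub_left]; ring
  simp_rw [hp]
  rw [integral_div, integral_sub (integrable_sphere (by fun_prop)) (integrable_sphere (by fun_prop)),
    mul_div_assoc', mul_sub, integral_sphere_inner_sq, integral_sphere_inner_sq,
    norm_add_sq_real, norm_sub_sq_real]
  ring

theorem sphereArea_pos (k : ℕ) : 0 < sphereArea k := by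
  refine ENNReal.toReal_pos ?_ (measure_ne_top _ _)
  rw [Measure.measure_univ_ne_zero]
  exact Measure.toSphere_ne_zero _

theorem sphereArea_pred {n : ℕ} (hn : n ≠ 0) :
    (sphereMeasure n).real Set.univ = sphereArea (n - 1) := by
  obtain ⟨m, rfl⟩ := Nat.exists_eq_succ_of_ne_zero hn
  rfl

/-- `L` parametrizes the hyperplane `v^⊥` isometrically. -/
def IsFrame {n : ℕ} (v : 𝔼 (n + 1)) (L : (𝔼 n) →ₗᵢ[ℝ] (𝔼 (n + 1))) : Prop :=
  LinearMap.range L.toLinearMap = (ℝ ∙ v)ᗮ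

namespace IsFrame

variable {n : ℕ} {v : 𝔼 (n + 1)} {L : (𝔼 n) →ₗᵢ[ℝ] (𝔼 (n + 1))}

theorem inner_apply (h : IsFrame v L) (y : 𝔼 n) : ⟪L y, v⟫ = 0 := by
  have : L y ∈ (ℝ ∙ v)ᗮ := h ▸ LinearMap.mem_range_self L.toLinearMap y
  exact mem_orthogonal_singleton_iff_inner_left.1 this

theorem exists_apply_eq (h : IsFrame v L) {u : 𝔼 (n + 1)} (hu : ⟪u, v⟫ = 0) : ∃ a, L a = u := by
  have : u ∈ LinearMap.range L.toLinearMap :=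
    h ▸ mem_orthogonal_singleton_iff_inner_left.2 hu
  exact this

theorem neg (h : IsFrame v L) : IsFrame (-v) L := by
  rw [IsFrame, h]
  congr 1
  rw [← Set.neg_singleton, span_neg]

theorem mem_T1Set (h : IsFrame v L) (hv : ‖v‖ = 1) (y : sphere (0 : 𝔼 n) 1) :
    (L y, v) ∈ T1Set n :=
  ⟨by simp, hv, h.inner_apply y⟩

theorem exists_of_norm_eq_one (hv : ‖v‖ = 1) : ∃ L, IsFrame (n := n) v L := by
  have : Fact (Module.finrank ℝ (𝔼 (n + 1)) = n + 1) := ⟨by simp⟩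
  have hd : Module.finrank ℝ (ℝ ∙ v)ᗮ = n :=
    finrank_orthogonal_span_singleton (by rintro rfl; simp at hv)
  let e := ((stdOrthonormalBasis ℝ (ℝ ∙ v)ᗮ).reindex (finCongr hd)).repr.symm
  refine ⟨(ℝ ∙ v)ᗮ.subtypeₗᵢ.comp e.toLinearIsometry, ?_⟩
  ext x
  refine ⟨?_, fun hx => ⟨e.symm ⟨x, hx⟩, by simp⟩⟩
  rintro ⟨y, rfl⟩
  exact (e y).2

theorem exists_eq_comp (h : IsFrame v L) {L' : (𝔼 n) →ₗᵢ[ℝ] (𝔼 (n + 1))} (h' : IsFrame v L') :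
    ∃ O : (𝔼 n) ≃ₗᵢ[ℝ] (𝔼 n), ∀ y, L' y = L (O y) := by
  choose f hf using fun y => h.exists_apply_eq (h'.inner_apply y)
  let O : (𝔼 n) →ₗᵢ[ℝ] (𝔼 n) :=
    { toFun := f
      map_add' := fun x y => L.injective (by simp [hf])
      map_smul' := fun c x => L.injective (by simp [hf])
      norm_map' := fun x => by
        change ‖f x‖ = ‖x‖
        rw [← L.norm_map, hf, L'.norm_map] }
  exact ⟨O.toLinearIsometryEquiv rfl, fun y => (hf y).symm⟩

theorem integral_eq (h : IsFrame v L) {L' : (𝔼 n) →ₗᵢ[ℝ] (𝔼 (n + 1))} (h' : IsFrame v L')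
    {F : Type*} [NormedAddCommGroup F] [NormedSpace ℝ F] (f : (𝔼 (n + 1)) → F) :
    ∫ y : sphere (0 : 𝔼 n) 1, f (L' y) ∂(sphereMeasure n) =
      ∫ y : sphere (0 : 𝔼 n) 1, f (L y) ∂(sphereMeasure n) := by
  obtain ⟨O, hO⟩ := h.exists_eq_comp h'
  simp_rw [hO]
  exact integral_sphere_comp O fun y => f (L y)

theorem reflection_comp (h : IsFrame v L) {w : 𝔼 (n + 1)} (hw : ‖v‖ = ‖w‖) :
    IsFrame w ((reflection (ℝ ∙ (v + w))).toLinearIsometry.comp L) := by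
  have hr : reflection (ℝ ∙ (v + w)) v = w := by
    have := reflection_sub (v := v) (w := -w) (by simpa using hw)
    rwa [sub_neg_eq_add, reflection_orthogonal_apply, neg_inj] at this
  ext x
  rw [mem_orthogonal_singleton_iff_inner_left]
  constructor
  · rintro ⟨y, rfl⟩
    change ⟪reflection (ℝ ∙ (v + w)) (L y), w⟫ = 0
    have := LinearIsometryEquiv.inner_map_map (reflection (ℝ ∙ (v + w))) (L y) v
    rwa [hr, h.inner_apply] at this
  · intro hx
    have : ⟪reflection (ℝ ∙ (v + w)) x, v⟫ = 0 := by
      rw [← LinearIsometryEquiv.inner_map_map (reflection (ℝ ∙ (v + w))), reflection_reflection,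
        hr, hx]
    obtain ⟨y, hy⟩ := h.exists_apply_eq this
    exact ⟨y, by simp [hy]⟩

end IsFrame

open Classical in
/-- The center `∫_{Σ_v} Ψ(x, v) x dσ_v(x)` of `Ψ(·, v)`. -/
noncomputable def center {n : ℕ} (Ψ : (𝔼 (n + 1)) → (𝔼 (n + 1)) → ℝ) (v : 𝔼 (n + 1)) :
    𝔼 (n + 1) :=
  if h : ∃ L : (𝔼 n) →ₗᵢ[ℝ] (𝔼 (n + 1)), IsFrame v L then
    ∫ y : sphere (0 : 𝔼 n) 1, Ψ (h.choose y) v • h.choose (y : 𝔼 n) ∂(sphereMeasure n)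
  else 0

section Center

variable {n : ℕ} {Ψ : (𝔼 (n + 1)) → (𝔼 (n + 1)) → ℝ} {v : 𝔼 (n + 1)}
  {L : (𝔼 n) →ₗᵢ[ℝ] (𝔼 (n + 1))}

theorem center_eq (Ψ : (𝔼 (n + 1)) → (𝔼 (n + 1)) → ℝ) (h : IsFrame v L) :
    center Ψ v = ∫ y : sphere (0 : 𝔼 n) 1, Ψ (L y) v • L (y : 𝔼 n) ∂(sphereMeasure n) := by
  have hex : ∃ L : (𝔼 n) →ₗᵢ[ℝ] (𝔼 (n + 1)), IsFrame v L := ⟨L, h⟩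
  rw [center, dif_pos hex]
  exact h.integral_eq hex.choose_spec fun x => Ψ x v • x

theorem continuous_comp_frame (hΨ : ContinuousOn (fun p => Ψ p.1 p.2) (T1Set n)) (hv : ‖v‖ = 1)
    (h : IsFrame v L) : Continuous fun y : sphere (0 : 𝔼 n) 1 => Ψ (L y) v :=
  hΨ.comp_continuous (f := fun y : sphere (0 : 𝔼 n) 1 => (L y, v)) (by fun_prop)
    (h.mem_T1Set hv)

theorem inner_center (hΨ : ContinuousOn (fun p => Ψ p.1 p.2) (T1Set n)) (hv : ‖v‖ = 1)
    (h : IsFrame v L) (u : 𝔼 (n + 1)) :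
    ⟪center Ψ v, u⟫ =
      ∫ y : sphere (0 : 𝔼 n) 1, Ψ (L y) v * ⟪L (y : 𝔼 n), u⟫ ∂(sphereMeasure n) := by
  have hc := continuous_comp_frame hΨ hv h
  have hcL : Continuous fun y : sphere (0 : 𝔼 n) 1 => Ψ (L y) v • L (y : 𝔼 n) :=
    hc.smul (by fun_prop)
  rw [center_eq Ψ h, real_inner_comm, ← integral_inner (integrable_sphere hcL)]
  simp_rw [inner_smul_right, real_inner_comm u]

theorem inner_center_self (hΨ : ContinuousOn (fun p => Ψ p.1 p.2) (T1Set n)) (hv : ‖v‖ = 1) :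
    ⟪center Ψ v, v⟫ = 0 := by
  obtain ⟨L, h⟩ := IsFrame.exists_of_norm_eq_one hv
  simp [inner_center hΨ hv h, h.inner_apply]

/-- Subtracting the linear function `α_n ⟨Z, ·⟩` shifts the center by `Z`. -/
theorem integral_sub_linear_mul_inner (hn : n ≠ 0)
    (hΨ : ContinuousOn (fun p => Ψ p.1 p.2) (T1Set n)) (hv : ‖v‖ = 1)
    (h : IsFrame v L) {Z u : 𝔼 (n + 1)} (hZ : ⟪Z, v⟫ = 0) (hu : ⟪u, v⟫ = 0) :
    ∫ y : sphere (0 : 𝔼 n) 1,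
      (Ψ (L y) v - n / sphereArea (n - 1) * ⟪Z, L y⟫) * ⟪L (y : 𝔼 n), u⟫ ∂(sphereMeasure n) =
      ⟪center Ψ v - Z, u⟫ := by
  have hc := continuous_comp_frame hΨ hv h
  obtain ⟨a, rfl⟩ := h.exists_apply_eq hZ
  obtain ⟨b, rfl⟩ := h.exists_apply_eq hu
  have hcL : Continuous fun y : sphere (0 : 𝔼 n) 1 => Ψ (L y) v * ⟪L (y : 𝔼 n), L b⟫ :=
    hc.mul (by fun_prop)
  have hA := (sphereArea_pos (n - 1)).ne'
  have key := integral_sphere_inner_mul_inner a b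
  rw [sphereArea_pred hn] at key
  simp_rw [sub_mul, mul_assoc]
  rw [integral_sub (integrable_sphere hcL) (integrable_sphere (by fun_prop)),
    integral_const_mul, inner_sub_left, inner_center hΨ hv h]
  simp_rw [LinearIsometry.inner_map_map]
  congr 1
  simp_rw [fun y : 𝔼 n => real_inner_comm b y]
  rw [div_mul_eq_mul_div, key, mul_div_cancel_left₀ _ hA, real_inner_comm]

theorem center_neg (hodd : ∀ x v, (x, v) ∈ T1Set n → Ψ x (-v) = -Ψ x v) (hv : ‖v‖ = 1) :
    center Ψ (-v) = -center Ψ v := by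
  obtain ⟨L, h⟩ := IsFrame.exists_of_norm_eq_one hv
  rw [center_eq Ψ h, center_eq Ψ h.neg, ← integral_neg]
  congr! 2 with y
  rw [hodd _ _ (h.mem_T1Set hv y), neg_smul]

theorem isCompact_T1Set (n : ℕ) : IsCompact (T1Set n) := by
  refine ((isCompact_sphere (0 : 𝔼 (n + 1)) 1).prod
    (isCompact_sphere (0 : 𝔼 (n + 1)) 1)).of_isClosed_subset ?_ ?_
  · exact (isClosed_eq (by fun_prop) (by fun_prop)).inter
      ((isClosed_eq (by fun_prop) (by fun_prop)).inter (isClosed_eq (by fun_prop) (by fun_prop)))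
  · rintro p ⟨h1, h2, -⟩
    simp [h1, h2]

theorem continuousOn_center (hΨ : ContinuousOn (fun p => Ψ p.1 p.2) (T1Set n)) :
    ContinuousOn (center Ψ) {v | ‖v‖ = 1} := by
  intro v₀ (hv₀ : ‖v₀‖ = 1)
  obtain ⟨L, h⟩ := IsFrame.exists_of_norm_eq_one hv₀
  obtain ⟨M, hM⟩ := (isCompact_T1Set n).exists_bound_of_continuousOn hΨ
  let R (v x : 𝔼 (n + 1)) : 𝔼 (n + 1) := reflection (ℝ ∙ (v₀ + v)) x
  have hframe {v : 𝔼 (n + 1)} (hv : ‖v‖ = 1) :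
      IsFrame v ((reflection (ℝ ∙ (v₀ + v))).toLinearIsometry.comp L) :=
    h.reflection_comp (hv₀.trans hv.symm)
  have hR (x : 𝔼 (n + 1)) : ContinuousAt (fun v => R v x) v₀ := by
    simp only [R, reflection_singleton_apply]
    have : ‖v₀ + v₀‖ ^ 2 ≠ 0 := by
      rw [← two_smul ℝ v₀, norm_smul, hv₀]; simp
    have : ContinuousAt (fun v : 𝔼 (n + 1) => ⟪v₀ + v, x⟫ / ‖v₀ + v‖ ^ 2) v₀ :=
      ContinuousAt.div (by fun_prop) (by fun_prop) this
    have hw : ContinuousAt (fun v : 𝔼 (n + 1) => v₀ + v) v₀ := by fun_prop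
    exact ((this.smul hw).const_smul 2).sub continuousAt_const
  have hcont : ContinuousWithinAt (fun v => ∫ y : sphere (0 : 𝔼 n) 1,
      Ψ (R v (L y)) v • R v (L y) ∂(sphereMeasure n)) {v | ‖v‖ = 1} v₀ := by
    refine continuousWithinAt_of_dominated (bound := fun _ => M) ?_ ?_ (integrable_const _) ?_
    · filter_upwards [self_mem_nhdsWithin] with v hv
      have hc := continuous_comp_frame hΨ hv (hframe hv)
      exact (hc.smul (by fun_prop : Continuous fun y : sphere (0 : 𝔼 n) 1 =>
        R v (L y))).aestronglyMeasurable
    · filter_upwards [self_mem_nhdsWithin] with v hv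
      refine .of_forall fun y => ?_
      have := hM _ ((hframe hv).mem_T1Set hv y)
      simpa [norm_smul, R] using this
    · refine .of_forall fun y => ?_
      have hRy := (hR (L y)).continuousWithinAt (s := {v | ‖v‖ = 1})
      have hmaps : Set.MapsTo (fun v => (R v (L y), v)) {v | ‖v‖ = 1} (T1Set n) :=
        fun v hv => (hframe hv).mem_T1Set hv y
      have hΨy : ContinuousWithinAt (fun v => Ψ (R v (L y)) v) {v | ‖v‖ = 1} v₀ :=
        ContinuousWithinAt.comp (f := fun v => (R v (L y), v)) (hΨ _ (hmaps hv₀))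
          (hRy.prodMk continuousWithinAt_id) hmaps
      exact hΨy.smul hRy
  exact hcont.congr (fun v hv => center_eq Ψ (hframe hv)) (center_eq Ψ (hframe hv₀))

end Center

/-- Every continuous function `Ψ` on `T₁S^n` that is odd in the second
variable decomposes uniquely as `Ψ(x,v) = φ(x,v) + α_n·⟨X(v),x⟩` with `X(v)` tangent
and `φ` of vanishing center; moreover `φ` and `X` are continuous and odd
(Proposition 3.3 of the paper). -/
theorem center_decomposition
    (n : ℕ) (hn : 2 ≤ n)
    (Ψ : EuclideanSpace ℝ (Fin (n + 1)) → EuclideanSpace ℝ (Fin (n + 1)) → ℝ)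
    (hΨc : ContinuousOn (fun p => Ψ p.1 p.2) (T1Set n))
    (hΨodd : ∀ x v, (x, v) ∈ T1Set n → Ψ x (-v) = -Ψ x v) :
    ∃ φ : EuclideanSpace ℝ (Fin (n + 1)) → EuclideanSpace ℝ (Fin (n + 1)) → ℝ,
      ∃ X : EuclideanSpace ℝ (Fin (n + 1)) → EuclideanSpace ℝ (Fin (n + 1)),
        IsCenterDecomp n Ψ φ X ∧
        (∀ φ' X', IsCenterDecomp n Ψ φ' X' →
          (∀ x v, (x, v) ∈ T1Set n → φ' x v = φ x v) ∧
          (∀ v, ‖v‖ = 1 → X' v = X v)) ∧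
        ContinuousOn (fun p => φ p.1 p.2) (T1Set n) ∧
        ContinuousOn X {v | ‖v‖ = 1} ∧
        (∀ x v, (x, v) ∈ T1Set n → φ x (-v) = -φ x v) ∧
        (∀ v, ‖v‖ = 1 → X (-v) = -X v) := by
  have hn0 : n ≠ 0 := by lia
  have hXc := continuousOn_center hΨc
  have hneg {x v : EuclideanSpace ℝ (Fin (n + 1))} (h : (x, v) ∈ T1Set n) :
      center Ψ (-v) = -center Ψ v := center_neg hΨodd h.2.1
  refine ⟨fun x v => Ψ x v - n / sphereArea (n - 1) * ⟪center Ψ v, x⟫, center Ψ,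
    ⟨fun v hv => inner_center_self hΨc hv, fun x v _ => by ring, fun v hv u hu L hL => ?_⟩,
    fun φ' X' ⟨hX', hdec, horth⟩ => ?_, ?_, hXc, fun x v hxv => ?_,
    fun v hv => center_neg hΨodd hv⟩
  · rw [integral_sub_linear_mul_inner hn0 hΨc hv hL (inner_center_self hΨc hv) hu]
    simp
  · have hXeq : ∀ v, ‖v‖ = 1 → X' v = center Ψ v := by
      intro v hv
      obtain ⟨L, hL⟩ := IsFrame.exists_of_norm_eq_one hv
      have hu : ⟪center Ψ v - X' v, v⟫ = 0 := by
        rw [inner_sub_left, inner_center_self hΨc hv, hX' v hv, sub_zero]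
      have hzero := integral_sub_linear_mul_inner hn0 hΨc hv hL (hX' v hv) hu
      have hφ' (y : sphere (0 : EuclideanSpace ℝ (Fin n)) 1) :
          Ψ (L y) v - n / sphereArea (n - 1) * ⟪X' v, L y⟫ = φ' (L y) v :=
        sub_eq_of_eq_add (hdec _ _ (hL.mem_T1Set hv y))
      simp_rw [hφ'] at hzero
      rw [horth v hv _ hu L hL] at hzero
      exact (sub_eq_zero.1 (inner_self_eq_zero.1 hzero.symm)).symm
    refine ⟨fun x v hxv => ?_, hXeq⟩
    simp only [hdec x v hxv, hXeq v hxv.2.1]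
    ring
  · refine hΨc.sub (continuousOn_const.mul ?_)
    have hX2 : ContinuousOn (fun p => center Ψ p.2) (T1Set n) :=
      hXc.comp continuousOn_snd fun p hp => hp.2.1
    exact hX2.inner continuousOn_fst
  · simp only [hΨodd x v hxv, hneg hxv, inner_neg_left]
    ring
end

section
/- Let n ≥ 2 and let f : S^n → ℝ be smooth. Then the Funk transform of f vanishes identically, i.e. ∫_{Σ_v} f dσ_v = 0 for every v ∈ S^n, if and only if f is odd, i.e. f(−x) = −f(x) for all x ∈ S^n. -/
open MeasureTheory
open scoped RealInnerProductSpace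

open Metric Pointwise in
/-- The surface measure of the unit sphere is invariant under linear isometries. -/
theorem integral_toSphere_comp_isometry {V : Type*} [NormedAddCommGroup V]
    [InnerProductSpace ℝ V] [FiniteDimensional ℝ V] [MeasurableSpace V] [BorelSpace V]
    (φ : V ≃ₗᵢ[ℝ] V) (h : V → ℝ) :
    ∫ y : sphere (0 : V) 1, h (φ y) ∂(volume : Measure V).toSphere =
      ∫ y : sphere (0 : V) 1, h y ∂(volume : Measure V).toSphere := by
  let T : sphere (0 : V) 1 ≃ₜ sphere (0 : V) 1 :=
    φ.toHomeomorph.subtype (p := (· ∈ sphere (0 : V) 1)) (q := (· ∈ sphere (0 : V) 1))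
      fun x ↦ by simp
  have hTval (y) : ((T y : sphere (0 : V) 1) : V) = φ y := rfl
  have hT : MeasurePreserving T (volume : Measure V).toSphere (volume : Measure V).toSphere := by
    refine ⟨T.measurable, Measure.ext fun s hs ↦ ?_⟩
    rw [Measure.map_apply T.measurable hs, Measure.toSphere_apply' _ hs,
      Measure.toSphere_apply' _ (T.measurable hs),
      ← φ.measurePreserving.measure_preimage_emb φ.toHomeomorph.measurableEmbedding
        (Set.Ioo (0 : ℝ) 1 • Set.image Subtype.val s)]
    congr 2
    ext x
    simp only [Set.mem_smul, Set.mem_image, Set.mem_preimage, exists_exists_and_eq_and]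
    constructor
    · rintro ⟨r, hr, y, hy, rfl⟩
      exact ⟨r, hr, T y, hy, (φ.map_smul r y).symm⟩
    · rintro ⟨r, hr, y, hy, hx⟩
      refine ⟨r, hr, T.symm y, by simpa using hy, φ.injective ?_⟩
      rw [φ.map_smul, ← hTval, T.apply_symm_apply]
      exact hx
  exact hT.integral_comp T.measurableEmbedding (fun y ↦ h y)

open Metric in
/-- The integral of an even power of a linear form over the unit sphere depends only on the norm
of the form. -/
theorem exists_integral_toSphere_inner_pow {V : Type*} [NormedAddCommGroup V]
    [InnerProductSpace ℝ V] [FiniteDimensional ℝ V] [Nontrivial V] [MeasurableSpace V]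
    [BorelSpace V] (m : ℕ) :
    ∃ c : ℝ, c ≠ 0 ∧ ∀ w : V,
      ∫ y : sphere (0 : V) 1, ⟪(y : V), w⟫ ^ (2 * m) ∂(volume : Measure V).toSphere =
        c * (‖w‖ ^ 2) ^ m := by
  obtain ⟨u, hu⟩ := exists_norm_eq V zero_le_one
  refine ⟨∫ y : sphere (0 : V) 1, ⟪(y : V), u⟫ ^ (2 * m) ∂(volume : Measure V).toSphere,
    ne_of_gt ?_, fun w ↦ ?_⟩
  · have hcont : Continuous fun y : sphere (0 : V) 1 ↦ ⟪(y : V), u⟫ ^ (2 * m) := by fun_prop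
    refine hcont.integral_pos_of_hasCompactSupport_nonneg_nonzero
      (HasCompactSupport.of_compactSpace _) (fun y ↦ (even_two_mul m).pow_nonneg _)
      (x := ⟨u, by simpa using hu⟩) ?_
    simp [hu]
  · have hnorm : ‖w‖ = ‖‖w‖ • u‖ := by simp [norm_smul, hu]
    have hrefl := Submodule.reflection_sub hnorm
    set ρ := (Submodule.span ℝ {w - ‖w‖ • u})ᗮ.reflection
    rw [← integral_toSphere_comp_isometry ρ fun y ↦ ⟪y, w⟫ ^ (2 * m), ← integral_mul_const]
    refine integral_congr_ae (.of_forall fun y ↦ ?_)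
    have : ⟪ρ y, w⟫ = ‖w‖ * ⟪(y : V), u⟫ := by
      rw [← ρ.inner_map_map, Submodule.reflection_reflection, hrefl, inner_smul_right]
    simp only [this, mul_pow, pow_mul]
    ring

/-- If a continuous function on a compact space is orthogonal to all powers of `u`, then it is
orthogonal to all continuous functions of `u`. -/
theorem integral_mul_comp_eq_zero_of_pow {X : Type*} [TopologicalSpace X] [CompactSpace X]
    [MeasurableSpace X] [BorelSpace X] (μ : Measure X) [IsFiniteMeasure μ]
    {φ u : X → ℝ} (hφ : Continuous φ) (hu : Continuous u)
    (hzero : ∀ m : ℕ, ∫ x, φ x * u x ^ m ∂μ = 0) {p : ℝ → ℝ} (hp : Continuous p) :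
    ∫ x, φ x * p (u x) ∂μ = 0 := by
  have hint {k : X → ℝ} (hk : Continuous k) : Integrable k μ :=
    integrableOn_univ.1 (hk.continuousOn.integrableOn_compact' isCompact_univ .univ)
  have hpoly (q : Polynomial ℝ) : ∫ x, φ x * q.eval (u x) ∂μ = 0 := by
    simp_rw [Polynomial.eval_eq_sum_range, Finset.mul_sum]
    rw [integral_finsetSum _ fun i _ ↦ hint (by fun_prop)]
    refine Finset.sum_eq_zero fun i _ ↦ ?_
    simp_rw [mul_left_comm (φ _)]
    rw [integral_const_mul, hzero, mul_zero]
  obtain ⟨R, hR⟩ := (isCompact_range hu).isBounded.exists_norm_le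
  have hmem (x : X) : u x ∈ Set.Icc (-R) R := abs_le.1 (hR _ ⟨x, rfl⟩)
  set C := ∫ x, |φ x| ∂μ
  have hC : 0 ≤ C := integral_nonneg fun x ↦ abs_nonneg _
  refine abs_eq_zero.1 (le_antisymm (le_of_forall_pos_le_add fun ε hε ↦ ?_) (abs_nonneg _))
  obtain ⟨q, hq⟩ := exists_polynomial_near_of_continuousOn (-R) R p hp.continuousOn
    (ε / (C + 1)) (by positivity)
  have hqc : Continuous fun x ↦ q.eval (u x) := q.continuous.comp hu
  calc |∫ x, φ x * p (u x) ∂μ| = |∫ x, φ x * (p (u x) - q.eval (u x)) ∂μ| := by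
        simp_rw [mul_sub]
        rw [integral_sub (hint (by fun_prop)) (hint (by fun_prop)), hpoly, sub_zero]
    _ ≤ ∫ x, |φ x| * (ε / (C + 1)) ∂μ := by
        refine (abs_integral_le_integral_abs).trans
          (integral_mono (hint (by fun_prop)) (hint (by fun_prop)) fun x ↦ ?_)
        simp only [abs_mul]
        gcongr
        rw [abs_sub_comm]
        exact (hq _ (hmem x)).le
    _ = C * (ε / (C + 1)) := integral_mul_const _ _
    _ ≤ 0 + ε := by
        rw [zero_add, mul_div_assoc', div_le_iff₀ (by positivity)]
        nlinarith

/-- The orthogonal group of a finite-dimensional Euclidean space is compact. -/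
theorem compactSpace_unitary_continuousLinearMap (E : Type*) [NormedAddCommGroup E]
    [InnerProductSpace ℝ E] [FiniteDimensional ℝ E] : CompactSpace (unitary (E →L[ℝ] E)) := by
  have : ProperSpace (E →L[ℝ] E) := FiniteDimensional.proper ℝ _
  refine isCompact_iff_compactSpace.1 (Metric.isCompact_of_isClosed_isBounded isClosed_unitary
    (isBounded_iff_forall_norm_le.2 ⟨1, fun g hg ↦ ?_⟩))
  exact ContinuousLinearMap.opNorm_le_bound _ zero_le_one fun x ↦ by
    rw [one_mul, Unitary.norm_map ⟨g, hg⟩ x]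

/-- The norm of the projection of `e` onto the range of an isometry that parametrizes the
hyperplane orthogonal to the unit vector `v`. -/
theorem norm_adjoint_sq_of_range_eq_orthogonal {V E : Type*} [NormedAddCommGroup V]
    [InnerProductSpace ℝ V] [FiniteDimensional ℝ V] [NormedAddCommGroup E]
    [InnerProductSpace ℝ E] [FiniteDimensional ℝ E] (L : V →ₗᵢ[ℝ] E) {v : E} (hv : ‖v‖ = 1)
    (hL : LinearMap.range L.toLinearMap = (Submodule.span ℝ {v})ᗮ) (e : E) :
    ‖L.toContinuousLinearMap.adjoint e‖ ^ 2 = ‖e‖ ^ 2 - ⟪v, e⟫ ^ 2 := by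
  have hvv : ⟪v, v⟫ = 1 := by simp [hv]
  have hmem : e - ⟪v, e⟫ • v ∈ LinearMap.range L.toLinearMap := by
    rw [hL, Submodule.mem_orthogonal_singleton_iff_inner_right, inner_sub_right,
      inner_smul_right, hvv, mul_one, sub_self]
  obtain ⟨y, hy⟩ := hmem
  have hy : L y = e - ⟪v, e⟫ • v := hy
  have hadj : L.toContinuousLinearMap.adjoint e = y := by
    refine ext_inner_left ℝ fun z ↦ ?_
    have hz : ⟪v, L z⟫ = 0 := by
      rw [← Submodule.mem_orthogonal_singleton_iff_inner_right, ← hL]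
      exact ⟨z, rfl⟩
    rw [ContinuousLinearMap.adjoint_inner_right, ← L.inner_map_map z y, hy, inner_sub_right,
      inner_smul_right, real_inner_comm v (L z), hz]
    simp
  rw [hadj, ← L.norm_map, hy, ← real_inner_self_eq_norm_sq, inner_sub_left, inner_sub_right,
    inner_sub_right, inner_smul_left, inner_smul_right, inner_smul_left, inner_smul_right, hvv,
    real_inner_self_eq_norm_sq, real_inner_comm e v]
  simp [sq]

open Metric in
/-- A continuous even function whose integrals over all central hyperplane sections of the sphere
vanish is nowhere positive on the sphere. -/
theorem nonpos_of_even_of_forall_integral_toSphere_eq_zero {V E : Type*} [NormedAddCommGroup V]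
    [InnerProductSpace ℝ V] [FiniteDimensional ℝ V] [Nontrivial V] [MeasurableSpace V]
    [BorelSpace V] [NormedAddCommGroup E] [InnerProductSpace ℝ E] [FiniteDimensional ℝ E]
    {F : E → ℝ} (hF : Continuous F) (heven : ∀ x, F (-x) = F x)
    (hzero : ∀ v : E, ‖v‖ = 1 → ∀ L : V →ₗᵢ[ℝ] E,
      LinearMap.range L.toLinearMap = (Submodule.span ℝ {v})ᗮ →
        ∫ y : sphere (0 : V) 1, F (L y) ∂(volume : Measure V).toSphere = 0)
    {e : E} (he : ‖e‖ = 1) (L : V →ₗᵢ[ℝ] E)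
    (hL : LinearMap.range L.toLinearMap = (Submodule.span ℝ {e})ᗮ) : F e ≤ 0 := by
  have := compactSpace_unitary_continuousLinearMap E
  let G := unitary (E →L[ℝ] E)
  let _ : MeasurableSpace G := borel G
  have : BorelSpace G := ⟨rfl⟩
  let μ : Measure G := Measure.haar
  let a (g : G) (x : E) : E := ((g⁻¹ : G) : E →L[ℝ] E) x
  have ha (x : E) : Continuous fun g ↦ a g x := by fun_prop
  have ha2 : Continuous fun q : G × sphere (0 : V) 1 ↦ a q.1 (L q.2) := by fun_prop
  have hnorm (g x) : ‖a g x‖ = ‖x‖ := Unitary.norm_map _ x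
  -- the hyperplane sections, moved by the orthogonal group
  let M (g : G) : V →ₗᵢ[ℝ] E := (Unitary.linearIsometryEquiv g⁻¹).toLinearIsometry.comp L
  have hM (g y) : M g y = a g (L y) := rfl
  have hMrange (g) : LinearMap.range (M g).toLinearMap = (Submodule.span ℝ {a g e})ᗮ := by
    have h := Submodule.map_orthogonal_equiv (Submodule.span ℝ {e})
      (Unitary.linearIsometryEquiv g⁻¹)
    rw [Submodule.map_span, Set.image_singleton, ← hL, ← LinearMap.range_comp] at h
    exact h
  -- self-adjointness of the Funk transform, in terms of averages over the orthogonal group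
  have hswap (y : sphere (0 : V) 1) (h : E → ℝ) :
      ∫ g, h (a g e) * F (a g (L y)) ∂μ = ∫ g, F (a g e) * h (a g (L y)) ∂μ := by
    have heq : ‖e‖ = ‖L y‖ := by simp [he]
    have hρ := Submodule.reflection_sub heq
    set ρ := (Submodule.span ℝ {e - L y})ᗮ.reflection
    have hρ' : ρ (L y) = e := by rw [← hρ]; exact Submodule.reflection_reflection _ _
    let k : G := Unitary.linearIsometryEquiv.symm ρ
    have hk (g x) : a (k⁻¹ * g) x = a g (ρ x) := by
      have hmul : (k⁻¹ * g)⁻¹ = g⁻¹ * k := (mul_inv_rev _ _).trans (congrArg _ (inv_inv k))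
      simp only [a, hmul]
      rfl
    rw [← integral_mul_left_eq_self _ k⁻¹]
    simp_rw [hk, hρ, hρ', mul_comm]
  have hpow (m : ℕ) : ∫ g, F (a g e) * (1 - ⟪a g e, e⟫ ^ 2) ^ m ∂μ = 0 := by
    obtain ⟨c, hc, hcw⟩ := exists_integral_toSphere_inner_pow (V := V) m
    have hinner (g : G) : ∫ y : sphere (0 : V) 1, ⟪a g (L y), e⟫ ^ (2 * m)
        ∂(volume : Measure V).toSphere = c * (1 - ⟪a g e, e⟫ ^ 2) ^ m := by
      have h := norm_adjoint_sq_of_range_eq_orthogonal (M g) ((hnorm g e).trans he) (hMrange g) e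
      rw [he, one_pow] at h
      rw [← h, ← hcw]
      refine integral_congr_ae (.of_forall fun y ↦ ?_)
      simp only [ContinuousLinearMap.adjoint_inner_right]
      rfl
    refine (mul_eq_zero.1 ?_).resolve_left hc
    calc c * ∫ g, F (a g e) * (1 - ⟪a g e, e⟫ ^ 2) ^ m ∂μ
        = ∫ g, ∫ y : sphere (0 : V) 1, F (a g e) * ⟪a g (L y), e⟫ ^ (2 * m)
            ∂(volume : Measure V).toSphere ∂μ := by
          simp_rw [integral_const_mul, hinner]
          rw [← integral_const_mul]
          simp_rw [mul_left_comm]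
      _ = ∫ y : sphere (0 : V) 1, ∫ g, F (a g e) * ⟪a g (L y), e⟫ ^ (2 * m) ∂μ
            ∂(volume : Measure V).toSphere :=
          integral_integral_swap_of_hasCompactSupport (by unfold Function.uncurry; fun_prop)
            (HasCompactSupport.of_compactSpace _)
      _ = ∫ y : sphere (0 : V) 1, ∫ g, ⟪a g e, e⟫ ^ (2 * m) * F (a g (L y)) ∂μ
            ∂(volume : Measure V).toSphere := by
          simp_rw [hswap _ fun x ↦ ⟪x, e⟫ ^ (2 * m)]
      _ = ∫ g, ∫ y : sphere (0 : V) 1, ⟪a g e, e⟫ ^ (2 * m) * F (a g (L y))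
            ∂(volume : Measure V).toSphere ∂μ :=
          (integral_integral_swap_of_hasCompactSupport (by unfold Function.uncurry; fun_prop)
            (HasCompactSupport.of_compactSpace _)).symm
      _ = 0 := by
          simp_rw [integral_const_mul, ← hM]
          simp [hzero _ ((hnorm _ e).trans he) _ (hMrange _)]
  by_contra! hpos
  obtain ⟨η, hη, hball⟩ := Metric.eventually_nhds_iff.1 (hF.continuousAt.eventually_const_lt hpos)
  have hnear (x : E) (hx : ‖x‖ = 1) (hxe : 1 - ⟪x, e⟫ ^ 2 < η ^ 2 / 2) : 0 < F x := by
    wlog ht : 0 ≤ ⟪x, e⟫ generalizing x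
    · rw [← heven]
      exact this (-x) (by simpa) (by simpa) (by simp; linarith)
    refine hball (lt_of_pow_lt_pow_left₀ 2 hη.le ?_)
    have hle : ⟪x, e⟫ ≤ 1 := by simpa [hx, he] using real_inner_le_norm x e
    rw [dist_eq_norm, norm_sub_sq_real, hx, he]
    nlinarith
  have hbump := integral_mul_comp_eq_zero_of_pow μ (φ := fun g ↦ F (a g e))
    (u := fun g ↦ 1 - ⟪a g e, e⟫ ^ 2) (by fun_prop) (by fun_prop) hpow
    (p := fun t ↦ max 0 (η ^ 2 / 2 - t)) (by fun_prop)
  refine (Continuous.integral_pos_of_hasCompactSupport_nonneg_nonzero (by fun_prop)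
    (HasCompactSupport.of_compactSpace _) (fun g ↦ ?_) (x := 1) ?_).ne' hbump
  · rcases le_or_gt (η ^ 2 / 2) (1 - ⟪a g e, e⟫ ^ 2) with h | h
    · simp [max_eq_left (sub_nonpos.2 h)]
    · exact mul_nonneg (hnear _ ((hnorm g e).trans he) h).le (le_max_left _ _)
  · have : a 1 e = e := by simp [a]
    have hη2 : 0 < η ^ 2 / 2 := by positivity
    simp [this, he, hpos.ne', hη2.le, hη.ne']

/-- Lemma A.1(i) of the paper. For a smooth function `f` on `S^n`
(realized as the restriction of a smooth function on `ℝ^{n+1}`), the Funk transform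
`v ↦ ∫_{Σ_v} f dσ_v` vanishes identically if and only if `f` is odd on `S^n`.
Integration over the equator `Σ_v` is realized through any linear isometry `L` of
`ℝ^n` onto the hyperplane `v^⊥`. -/
theorem funk_transform_kernel
    (n : ℕ) (hn : 2 ≤ n)
    (f : EuclideanSpace ℝ (Fin (n + 1)) → ℝ)
    (hf : ContDiff ℝ (⊤ : ℕ∞) f) :
    (∀ v : EuclideanSpace ℝ (Fin (n + 1)), ‖v‖ = 1 →
        ∀ L : EuclideanSpace ℝ (Fin n) →ₗᵢ[ℝ] EuclideanSpace ℝ (Fin (n + 1)),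
          LinearMap.range L.toLinearMap = (Submodule.span ℝ {v})ᗮ →
          (∫ y : Metric.sphere (0 : EuclideanSpace ℝ (Fin n)) 1,
            f (L ↑y) ∂(sphereMeasure n)) = 0) ↔
      (∀ x : EuclideanSpace ℝ (Fin (n + 1)), ‖x‖ = 1 → f (-x) = -f x) := by
  constructor
  · intro hzero
    have : NeZero n := ⟨by lia⟩
    let F (x : EuclideanSpace ℝ (Fin (n + 1))) : ℝ := f x + f (-x)
    have hFc : Continuous F := by have := hf.continuous; fun_prop
    have heven (x) : F (-x) = F x := by simp [F, add_comm]
    have hF (v : EuclideanSpace ℝ (Fin (n + 1))) (hv : ‖v‖ = 1)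
        (L : EuclideanSpace ℝ (Fin n) →ₗᵢ[ℝ] EuclideanSpace ℝ (Fin (n + 1)))
        (hL : LinearMap.range L.toLinearMap = (Submodule.span ℝ {v})ᗮ) :
        ∫ y : Metric.sphere (0 : EuclideanSpace ℝ (Fin n)) 1, F (L y)
          ∂(volume : Measure (EuclideanSpace ℝ (Fin n))).toSphere = 0 := by
      have hfL : Continuous fun y : Metric.sphere (0 : EuclideanSpace ℝ (Fin n)) 1 ↦ f (L y) := by
        have := hf.continuous
        fun_prop
      have hfnegL : Continuous
          fun y : Metric.sphere (0 : EuclideanSpace ℝ (Fin n)) 1 ↦ f (-L y) := by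
        have := hf.continuous
        fun_prop
      have hfun := integral_toSphere_comp_isometry (LinearIsometryEquiv.neg ℝ) (fun y ↦ f (L y))
      simp only [LinearIsometryEquiv.coe_neg, map_neg] at hfun
      have h0 := hzero v hv L hL
      rw [sphereMeasure] at h0
      rw [integral_add (hfL.integrable_of_hasCompactSupport (.of_compactSpace _))
        (hfnegL.integrable_of_hasCompactSupport (.of_compactSpace _)), hfun, h0, add_zero]
    intro e he
    have : Fact (Module.finrank ℝ (EuclideanSpace ℝ (Fin (n + 1))) = n + 1) := ⟨by simp⟩
    have he0 : e ≠ 0 := norm_ne_zero_iff.1 (by simp [he])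
    let ψ := (OrthonormalBasis.fromOrthogonalSpanSingleton (𝕜 := ℝ) n he0).repr.symm
    let L := (Submodule.span ℝ {e})ᗮ.subtypeₗᵢ.comp ψ.toLinearIsometry
    have hL : LinearMap.range L.toLinearMap = (Submodule.span ℝ {e})ᗮ := by
      ext x
      constructor
      · rintro ⟨y, rfl⟩
        exact (ψ y).2
      · intro hx
        exact ⟨ψ.symm ⟨x, hx⟩, congrArg Subtype.val (ψ.apply_symm_apply ⟨x, hx⟩)⟩
    have hle := nonpos_of_even_of_forall_integral_toSphere_eq_zero hFc heven hF he L hL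
    have hge := nonpos_of_even_of_forall_integral_toSphere_eq_zero (F := fun x ↦ -F x) hFc.neg
      (fun x ↦ by rw [heven]) (fun v hv L hL ↦ by rw [integral_neg, hF v hv L hL, neg_zero])
      he L hL
    simp only [F] at hle hge
    linarith
  · intro hodd v _ L _
    have hfun := integral_toSphere_comp_isometry (LinearIsometryEquiv.neg ℝ) (fun y ↦ f (L y))
    have hneg (y : Metric.sphere (0 : EuclideanSpace ℝ (Fin n)) 1) : f (-L y) = -f (L y) :=
      hodd _ (by simp)
    simp only [LinearIsometryEquiv.coe_neg, map_neg, hneg, integral_neg] at hfun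
    rw [sphereMeasure]
    linarith
end

section
/- Let n ≥ 2 and let f, g : S^n → ℝ be continuous. Then ∫_{S^n} F(f)(v)·g(v) dσ_n(v) = ∫_{S^n} f(x)·F(g)(x) dσ_n(x), where F denotes the Funk transform and σ_n the surface measure of S^n; that is, the Funk transform is self-adjoint with respect to the L² pairing on S^n. -/
open MeasureTheory
open scoped RealInnerProductSpace

section

variable {E F G : Type*} [NormedAddCommGroup E] [InnerProductSpace ℝ E]
  [NormedAddCommGroup F] [InnerProductSpace ℝ F] [NormedAddCommGroup G] [InnerProductSpace ℝ G]

/-- The map between unit spheres induced by a linear isometry. -/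
def sphereMap (L : E →ₗᵢ[ℝ] F) (x : Metric.sphere (0 : E) 1) : Metric.sphere (0 : F) 1 :=
  ⟨L x, by simp⟩

@[simp]
theorem coe_sphereMap (L : E →ₗᵢ[ℝ] F) (x : Metric.sphere (0 : E) 1) :
    (sphereMap L x : F) = L x := rfl

theorem continuous_sphereMap (L : E →ₗᵢ[ℝ] F) : Continuous (sphereMap L) :=
  (L.continuous.comp continuous_subtype_val).subtype_mk _

/-- A measure-preserving linear isometry equivalence preserves the induced surface measures. -/
theorem measurePreserving_sphereMap [MeasurableSpace E] [BorelSpace E] [MeasurableSpace F]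
    [BorelSpace F] {μ : Measure E} {ν : Measure F} (e : E ≃ₗᵢ[ℝ] F) (he : MeasurePreserving e μ ν) :
    MeasurePreserving (sphereMap e.toLinearIsometry) μ.toSphere ν.toSphere := by
  have hc := (continuous_sphereMap e.toLinearIsometry).measurable
  refine ⟨hc, Measure.ext fun s hs => ?_⟩
  rw [Measure.map_apply hc hs, Measure.toSphere_apply' _ (hc hs), Measure.toSphere_apply' _ hs,
    ← he.measure_preimage_emb e.toHomeomorph.measurableEmbedding,
    e.toLinearEquiv.finrank_eq]
  congr 2
  ext x
  simp only [Set.mem_smul, Set.mem_preimage, Set.mem_image]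
  constructor
  · rintro ⟨r, hr, _, ⟨y, hy, rfl⟩, rfl⟩
    exact ⟨r, hr, _, ⟨_, hy, rfl⟩, by simp⟩
  · rintro ⟨r, hr, _, ⟨y, hy, rfl⟩, h⟩
    refine ⟨r, hr, _, ⟨sphereMap e.symm.toLinearIsometry y, ?_, rfl⟩, ?_⟩
    · convert hy
      ext1
      simp
    · apply e.injective
      simpa using h

/-- A linear isometry equivalence carries an isometric parametrization of `vᗮ` to
one of the orthogonal complement of the image of `v`. -/
theorem range_comp_linearIsometry_eq_orthogonal (e : E ≃ₗᵢ[ℝ] E) {L : G →ₗᵢ[ℝ] E} {v : E}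
    (hL : LinearMap.range L.toLinearMap = (ℝ ∙ v)ᗮ) :
    LinearMap.range (e.toLinearIsometry.comp L).toLinearMap = (ℝ ∙ e v)ᗮ := by
  have h := Submodule.map_orthogonal_equiv (ℝ ∙ v) e
  rw [← hL, Submodule.map_span, Set.image_singleton] at h
  exact (LinearMap.range_comp _ _).trans h

section

variable [CompleteSpace E]

/-- The action of the inverse of a unitary operator on the unit sphere. -/
noncomputable def invRotate (u : unitary (E →L[ℝ] E)) :
    Metric.sphere (0 : E) 1 → Metric.sphere (0 : E) 1 :=
  sphereMap (Unitary.linearIsometryEquiv u⁻¹).toLinearIsometry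

theorem invRotate_mul (u v : unitary (E →L[ℝ] E)) (x : Metric.sphere (0 : E) 1) :
    invRotate (u * v) x = invRotate v (invRotate u x) := by
  ext1
  simp [invRotate]

theorem Continuous.invRotate {X : Type*} [TopologicalSpace X] {u : X → unitary (E →L[ℝ] E)}
    {x : X → Metric.sphere (0 : E) 1} (hu : Continuous u) (hx : Continuous x) :
    Continuous fun t => invRotate (u t) (x t) := by
  refine Continuous.subtype_mk (f := fun t =>
    (((u t)⁻¹ : unitary (E →L[ℝ] E)) : E →L[ℝ] E) (x t : E)) ?_ _
  fun_prop

theorem exists_invRotate_swap (x y : Metric.sphere (0 : E) 1) :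
    ∃ u : unitary (E →L[ℝ] E), invRotate u x = y ∧ invRotate u y = x := by
  have h : ‖(x : E)‖ = ‖(y : E)‖ := by simp
  refine ⟨Unitary.linearIsometryEquiv.symm ((ℝ ∙ ((x : E) - y))ᗮ.reflection)⁻¹, ?_, ?_⟩
  · ext1
    simpa [invRotate] using Submodule.reflection_sub h
  · ext1
    have := congrArg ((ℝ ∙ ((x : E) - y))ᗮ.reflection) (Submodule.reflection_sub h)
    rw [Submodule.reflection_reflection] at this
    simpa [invRotate] using this.symm

instance [FiniteDimensional ℝ E] : CompactSpace (unitary (E →L[ℝ] E)) := by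
  refine isCompact_iff_compactSpace.mp (Metric.isCompact_of_isClosed_isBounded isClosed_unitary ?_)
  refine (Metric.isBounded_closedBall (x := (0 : E →L[ℝ] E)) (r := 1)).subset fun u hu => ?_
  rw [mem_closedBall_zero_iff]
  exact (Unitary.linearIsometryEquiv ⟨u, hu⟩).toLinearIsometry.norm_toContinuousLinearMap_le

/-- A function on the sphere is continuous once its pullback to the orthogonal group is. -/
theorem continuous_of_comp_invRotate [FiniteDimensional ℝ E]
    {X : Type*} [TopologicalSpace X] {f : Metric.sphere (0 : E) 1 → X}
    (a : Metric.sphere (0 : E) 1)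
    (h : Continuous fun u : unitary (E →L[ℝ] E) => f (invRotate u a)) : Continuous f := by
  have hc : Continuous fun u : unitary (E →L[ℝ] E) => invRotate u a :=
    continuous_id.invRotate continuous_const
  have hs : Function.Surjective fun u : unitary (E →L[ℝ] E) => invRotate u a := fun y =>
    (exists_invRotate_swap a y).imp fun _ hu => hu.1
  exact (hc.isClosedMap.isQuotientMap hc hs).continuous_iff.mpr h

variable [MeasurableSpace (unitary (E →L[ℝ] E))]
  [BorelSpace (unitary (E →L[ℝ] E))] (μ : Measure (unitary (E →L[ℝ] E)))

/-- Pair averages over the orthogonal group are symmetric. -/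
theorem integral_invRotate_mul_comm [μ.IsMulLeftInvariant] (f g : Metric.sphere (0 : E) 1 → ℝ)
    (x y : Metric.sphere (0 : E) 1) :
    ∫ u, f (invRotate u x) * g (invRotate u y) ∂μ =
      ∫ u, g (invRotate u x) * f (invRotate u y) ∂μ := by
  obtain ⟨k, hx, hy⟩ := exists_invRotate_swap x y
  rw [← integral_mul_left_eq_self _ k]
  simp only [invRotate_mul, hx, hy, mul_comm]

theorem integral_invRotate_eq [μ.IsMulLeftInvariant] (f : Metric.sphere (0 : E) 1 → ℝ)
    (x y : Metric.sphere (0 : E) 1) :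
    ∫ u, f (invRotate u x) ∂μ = ∫ u, f (invRotate u y) ∂μ := by
  simpa using integral_invRotate_mul_comm μ f 1 x y

variable [FiniteDimensional ℝ E]

/-- Integration over the sphere is averaging over the orthogonal group. -/
theorem integral_toSphere_eq_integral_invRotate [MeasurableSpace E] [BorelSpace E]
    [μ.IsMulLeftInvariant] [IsProbabilityMeasure μ]
    {f : Metric.sphere (0 : E) 1 → ℝ} (hf : Continuous f) (a : Metric.sphere (0 : E) 1) :
    ∫ x, f x ∂(volume : Measure E).toSphere =
      (volume : Measure E).toSphere.real Set.univ * ∫ u, f (invRotate u a) ∂μ := by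
  have hinv (u : unitary (E →L[ℝ] E)) : ∫ x, f (invRotate u x) ∂(volume : Measure E).toSphere =
      ∫ x, f x ∂(volume : Measure E).toSphere := by
    let e := Unitary.linearIsometryEquiv u⁻¹
    have he := measurePreserving_sphereMap e e.measurePreserving
    conv_rhs => rw [← he.map_eq]
    rw [integral_map he.measurable.aemeasurable (hf.aestronglyMeasurable)]
    rfl
  calc ∫ x, f x ∂(volume : Measure E).toSphere
      = ∫ u, ∫ x, f (invRotate u x) ∂(volume : Measure E).toSphere ∂μ := by simp [hinv]
    _ = ∫ x, ∫ u, f (invRotate u x) ∂μ ∂(volume : Measure E).toSphere :=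
        integral_integral_swap_of_hasCompactSupport (f := fun u x => f (invRotate u x))
          (hf.comp (continuous_fst.invRotate continuous_snd))
          (HasCompactSupport.of_compactSpace _)
    _ = _ := by simp [integral_invRotate_eq μ f _ a]

/-- If the pullback of `F` to the orthogonal group is an equatorial integral of `f`, then the
pairing of `F` with `g` is an average of pair averages of `f` and `g`. -/
theorem integral_mul_toSphere_eq_integral_integral_invRotate [MeasurableSpace E] [BorelSpace E]
    [FiniteDimensional ℝ G] [MeasurableSpace G] [BorelSpace G]
    [μ.IsMulLeftInvariant] [IsProbabilityMeasure μ]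
    {f g F : Metric.sphere (0 : E) 1 → ℝ} (hf : Continuous f) (hg : Continuous g)
    (a : Metric.sphere (0 : E) 1) (L : G →ₗᵢ[ℝ] E)
    (hF : ∀ u : unitary (E →L[ℝ] E), F (invRotate u a) =
      ∫ y, f (invRotate u (sphereMap L y)) ∂(volume : Measure G).toSphere) :
    ∫ x, F x * g x ∂(volume : Measure E).toSphere =
      (volume : Measure E).toSphere.real Set.univ *
        ∫ y, ∫ u, f (invRotate u (sphereMap L y)) * g (invRotate u a) ∂μ
          ∂(volume : Measure G).toSphere := by
  have hfc : Continuous fun p : unitary (E →L[ℝ] E) × Metric.sphere (0 : G) 1 =>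
      f (invRotate p.1 (sphereMap L p.2)) :=
    hf.comp (continuous_fst.invRotate ((continuous_sphereMap L).comp continuous_snd))
  have hgc : Continuous fun p : unitary (E →L[ℝ] E) × Metric.sphere (0 : G) 1 =>
      g (invRotate p.1 a) :=
    hg.comp (continuous_fst.invRotate continuous_const)
  have hFc : Continuous F := by
    refine continuous_of_comp_invRotate a ?_
    simp only [hF]
    simpa using continuous_parametric_integral_of_continuous
      (μ := (volume : Measure G).toSphere) hfc isCompact_univ
  rw [integral_toSphere_eq_integral_invRotate μ (f := fun x => F x * g x) (hFc.mul hg) a]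
  simp only [hF, ← integral_mul_const]
  rw [integral_integral_swap_of_hasCompactSupport (hfc.mul hgc)
    (HasCompactSupport.of_compactSpace _)]

end

/-- Functions on the sphere given at every rotation of `a` by integration over the corresponding
rotation of the subsphere `L` satisfy the self-adjointness relation. -/
theorem integral_mul_comm_of_invRotate [CompleteSpace E] [FiniteDimensional ℝ E]
    [MeasurableSpace E] [BorelSpace E] [FiniteDimensional ℝ G] [MeasurableSpace G] [BorelSpace G]
    {f g Ff Fg : Metric.sphere (0 : E) 1 → ℝ} (hf : Continuous f) (hg : Continuous g)
    (a : Metric.sphere (0 : E) 1) (L : G →ₗᵢ[ℝ] E)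
    (hFf : ∀ u : unitary (E →L[ℝ] E), Ff (invRotate u a) =
      ∫ y, f (invRotate u (sphereMap L y)) ∂(volume : Measure G).toSphere)
    (hFg : ∀ u : unitary (E →L[ℝ] E), Fg (invRotate u a) =
      ∫ y, g (invRotate u (sphereMap L y)) ∂(volume : Measure G).toSphere) :
    ∫ x, Ff x * g x ∂(volume : Measure E).toSphere =
      ∫ x, f x * Fg x ∂(volume : Measure E).toSphere := by
  let _ : MeasurableSpace (unitary (E →L[ℝ] E)) := borel _
  have : BorelSpace (unitary (E →L[ℝ] E)) := ⟨rfl⟩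
  let μ : Measure (unitary (E →L[ℝ] E)) := Measure.haarMeasure ⊤
  have : IsProbabilityMeasure μ := ⟨Measure.haarMeasure_self⟩
  simp only [mul_comm (f _)]
  rw [integral_mul_toSphere_eq_integral_integral_invRotate μ hf hg a L hFf,
    integral_mul_toSphere_eq_integral_integral_invRotate μ hg hf a L hFg]
  simp only [integral_invRotate_mul_comm μ f g]

end

/-- The Funk transform is self-adjoint with respect to the `L²` pairing
on `S^n`: `∫_{S^n} F(f)·g dσ_n = ∫_{S^n} f·F(g) dσ_n` for continuous `f, g` on `S^n`.
Here `Ff` (resp. `Fg`) is the Funk transform of `f` (resp. `g`): its value at a unit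
vector `v` is the integral of `f` over the equator `Σ_v`, realized through any linear
isometry `L` of `ℝ^n` onto `v^⊥` (Section 8 of the paper, case `ρ = 0`, `Φ = 0`). -/
theorem funk_transform_self_adjoint
    (n : ℕ) (hn : 2 ≤ n)
    (f g Ff Fg : EuclideanSpace ℝ (Fin (n + 1)) → ℝ)
    (hf : ContinuousOn f (Metric.sphere (0 : EuclideanSpace ℝ (Fin (n + 1))) 1))
    (hg : ContinuousOn g (Metric.sphere (0 : EuclideanSpace ℝ (Fin (n + 1))) 1))
    (hFf : ∀ v : EuclideanSpace ℝ (Fin (n + 1)), ‖v‖ = 1 →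
      ∀ L : EuclideanSpace ℝ (Fin n) →ₗᵢ[ℝ] EuclideanSpace ℝ (Fin (n + 1)),
        LinearMap.range L.toLinearMap = (Submodule.span ℝ {v})ᗮ →
        Ff v = ∫ y : Metric.sphere (0 : EuclideanSpace ℝ (Fin n)) 1,
          f (L ↑y) ∂(sphereMeasure n))
    (hFg : ∀ v : EuclideanSpace ℝ (Fin (n + 1)), ‖v‖ = 1 →
      ∀ L : EuclideanSpace ℝ (Fin n) →ₗᵢ[ℝ] EuclideanSpace ℝ (Fin (n + 1)),
        LinearMap.range L.toLinearMap = (Submodule.span ℝ {v})ᗮ →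
        Fg v = ∫ y : Metric.sphere (0 : EuclideanSpace ℝ (Fin n)) 1,
          g (L ↑y) ∂(sphereMeasure n)) :
    (∫ v : Metric.sphere (0 : EuclideanSpace ℝ (Fin (n + 1))) 1,
        Ff ↑v * g ↑v ∂(sphereMeasure (n + 1))) =
      ∫ x : Metric.sphere (0 : EuclideanSpace ℝ (Fin (n + 1))) 1,
        f ↑x * Fg ↑x ∂(sphereMeasure (n + 1)) := by
  let E := EuclideanSpace ℝ (Fin (n + 1))
  let a : Metric.sphere (0 : E) 1 :=
    ⟨EuclideanSpace.single 0 1, by rw [mem_sphere_zero_iff_norm]; simp [E]⟩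
  have : Fact (Module.finrank ℝ E = n + 1) := ⟨by simp [E]⟩
  have ha : (a : E) ≠ 0 := ne_zero_of_mem_unit_sphere a
  let L : EuclideanSpace ℝ (Fin n) →ₗᵢ[ℝ] E := (ℝ ∙ (a : E))ᗮ.subtypeₗᵢ.comp
    (OrthonormalBasis.fromOrthogonalSpanSingleton n ha).repr.symm.toLinearIsometry
  have hL : LinearMap.range L.toLinearMap = (ℝ ∙ (a : E))ᗮ := by
    refine (LinearMap.range_comp_of_range_eq_top _ (LinearEquiv.range
      (OrthonormalBasis.fromOrthogonalSpanSingleton n ha).repr.symm.toLinearEquiv)).trans ?_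
    exact Submodule.range_subtype _
  have funk_invRotate (h H : E → ℝ)
      (hH : ∀ v : E, ‖v‖ = 1 → ∀ L : EuclideanSpace ℝ (Fin n) →ₗᵢ[ℝ] E,
        LinearMap.range L.toLinearMap = (ℝ ∙ v)ᗮ → H v = ∫ y, h (L ↑y) ∂(sphereMeasure n))
      (u : unitary (E →L[ℝ] E)) : H (invRotate u a) =
        ∫ y, h (invRotate u (sphereMap L y))
          ∂(volume : Measure (EuclideanSpace ℝ (Fin n))).toSphere :=
    hH _ (by simp) _ (range_comp_linearIsometry_eq_orthogonal _ hL)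
  exact integral_mul_comm_of_invRotate (Ff := fun v => Ff v) (Fg := fun v => Fg v)
    hf.domRestrict hg.domRestrict a L (funk_invRotate f Ff hFf) (funk_invRotate g Fg hFg)
end

section
/- Let n ≥ 2 and let f : S^n → ℝ be continuous. Then ∫_{S^n} F(f)(v) dσ_n(v) = ω_{n−1} · ∫_{S^n} f dσ_n, where F is the Funk transform, σ_n the surface measure of S^n, and ω_{n−1} the total surface measure of the unit sphere S^{n−1} ⊂ ℝ^n. -/
open MeasureTheory
open scoped RealInnerProductSpace

open Metric Module Set
open scoped Pointwise

section OrthogonalAverage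

/-- The orthogonal group of a real inner product space, as a group of continuous linear maps. -/
abbrev OrthogonalMaps (E : Type*) [NormedAddCommGroup E] [InnerProductSpace ℝ E]
    [CompleteSpace E] : Type _ :=
  unitary (E →L[ℝ] E)

variable {E : Type*} [NormedAddCommGroup E] [InnerProductSpace ℝ E] [FiniteDimensional ℝ E]

/-- Evaluation of orthogonal maps is jointly continuous after precomposition with continuous maps. -/
theorem Continuous.orthogonalMaps_apply {X : Type*} [TopologicalSpace X]
    {u : X → OrthogonalMaps E} {y : X → E} (hu : Continuous u) (hy : Continuous y) :
    Continuous fun x => (u x : E →L[ℝ] E) (y x) :=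
  (continuous_subtype_val.comp hu).clm_apply hy

/-- The orthogonal group of a finite-dimensional real inner product space is compact. -/
theorem compactSpace_orthogonalMaps : CompactSpace (OrthogonalMaps E) := by
  have : ProperSpace (E →L[ℝ] E) := FiniteDimensional.proper ℝ _
  refine isCompact_iff_compactSpace.mp
    (Metric.isCompact_of_isClosed_isBounded isClosed_unitary ?_)
  refine (Metric.isBounded_closedBall (x := (0 : E →L[ℝ] E)) (r := 1)).subset fun u hu => ?_
  rw [mem_closedBall_zero_iff]
  refine u.opNorm_le_bound zero_le_one fun x => ?_
  rw [one_mul, Unitary.norm_map ⟨u, hu⟩ x]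

/-- The orthogonal group acts transitively on vectors of a given norm. -/
theorem exists_orthogonalMaps_apply_eq {v w : E} (h : ‖v‖ = ‖w‖) :
    ∃ u : OrthogonalMaps E, (u : E →L[ℝ] E) v = w :=
  ⟨Unitary.linearIsometryEquiv.symm (Submodule.reflection (Submodule.span ℝ {v - w})ᗮ),
    Submodule.reflection_sub h⟩

/-- The average of `f` over an orbit of the orthogonal group depends only on the norm of the
base point. -/
theorem integral_orthogonalMaps_inv_apply_eq [MeasurableSpace (OrthogonalMaps E)]
    [BorelSpace (OrthogonalMaps E)] (μ : Measure (OrthogonalMaps E))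
    [μ.IsMulLeftInvariant] (f : E → ℝ) {v w : E} (h : ‖v‖ = ‖w‖) :
    ∫ u, f (((u⁻¹ : OrthogonalMaps E) : E →L[ℝ] E) v) ∂μ =
      ∫ u, f (((u⁻¹ : OrthogonalMaps E) : E →L[ℝ] E) w) ∂μ := by
  obtain ⟨k, rfl⟩ := exists_orthogonalMaps_apply_eq h
  rw [← integral_mul_left_eq_self _ k⁻¹]
  simp only [mul_inv_rev, inv_inv]
  rfl

variable [MeasurableSpace E] [BorelSpace E]

/-- Linear isometries preserve the surface measure of the unit sphere. -/
theorem integral_toSphere_comp_linearIsometryEquiv (e : E ≃ₗᵢ[ℝ] E) (f : E → ℝ) :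
    ∫ x : sphere (0 : E) 1, f (e x) ∂(volume : Measure E).toSphere =
      ∫ x : sphere (0 : E) 1, f x ∂(volume : Measure E).toSphere := by
  let φ : sphere (0 : E) 1 ≃ₜ sphere (0 : E) 1 :=
    e.toHomeomorph.subtype fun x => by simp
  have hφ : MeasurePreserving φ (volume : Measure E).toSphere (volume : Measure E).toSphere := by
    refine ⟨φ.measurable, Measure.ext fun s hs => ?_⟩
    rw [Measure.map_apply φ.measurable hs, Measure.toSphere_apply' _ (φ.measurable hs),
      Measure.toSphere_apply' _ hs]
    congr 1
    have : e '' (Ioo (0 : ℝ) 1 • ((↑) '' (φ ⁻¹' s) : Set E)) = Ioo (0 : ℝ) 1 • ((↑) '' s) := by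
      rw [← image2_smul, ← image2_smul, image_image2]
      simp only [map_smul]
      rw [← image2_image_right (f := fun (r : ℝ) (x : E) => r • x), image_image]
      congr 1
      calc (fun x : sphere (0 : E) 1 => e x) '' (φ ⁻¹' s)
          = (fun x => ((φ x : sphere (0 : E) 1) : E)) '' (φ ⁻¹' s) := rfl
        _ = (↑) '' s := by
          rw [← image_image (fun x : sphere (0 : E) 1 => (x : E)) φ,
            image_preimage_eq _ φ.surjective]
    rw [← this]
    conv_rhs => rw [← e.measurePreserving.measure_preimage_emb e.toHomeomorph.measurableEmbedding,
      preimage_image_eq _ e.injective]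
  exact hφ.integral_comp φ.measurableEmbedding fun x => f x

/-- The surface integral of a continuous function is its orthogonal average times the area. -/
theorem integral_toSphere_eq_mul_integral_orthogonalMaps [MeasurableSpace (OrthogonalMaps E)]
    [BorelSpace (OrthogonalMaps E)] (μ : Measure (OrthogonalMaps E))
    [μ.IsMulLeftInvariant] [IsProbabilityMeasure μ] {f : E → ℝ}
    (hf : ContinuousOn f (sphere 0 1)) {v : E} (hv : ‖v‖ = 1) :
    ∫ x : sphere (0 : E) 1, f x ∂(volume : Measure E).toSphere =
      (volume : Measure E).toSphere.real univ *
        ∫ u, f (((u⁻¹ : OrthogonalMaps E) : E →L[ℝ] E) v) ∂μ := by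
  have := compactSpace_orthogonalMaps (E := E)
  calc ∫ x : sphere (0 : E) 1, f x ∂(volume : Measure E).toSphere
      = ∫ u, ∫ x : sphere (0 : E) 1, f (((u⁻¹ : OrthogonalMaps E) : E →L[ℝ] E) x)
          ∂(volume : Measure E).toSphere ∂μ := by
        have (u : OrthogonalMaps E) := integral_toSphere_comp_linearIsometryEquiv
          (Unitary.linearIsometryEquiv u⁻¹) f
        refine Eq.trans ?_ (integral_congr_ae (.of_forall this)).symm
        simp
    _ = ∫ x : sphere (0 : E) 1, ∫ u, f (((u⁻¹ : OrthogonalMaps E) : E →L[ℝ] E) x) ∂μ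
          ∂(volume : Measure E).toSphere := by
        refine integral_integral_swap_of_hasCompactSupport ?_ (HasCompactSupport.of_compactSpace _)
        refine hf.comp_continuous (f := fun p : OrthogonalMaps E × sphere (0 : E) 1 =>
          ((p.1⁻¹ : OrthogonalMaps E) : E →L[ℝ] E) p.2)
          (Continuous.orthogonalMaps_apply (by fun_prop) (by fun_prop)) fun p => ?_
        simp [Unitary.norm_map]
    _ = _ := by
        have (x : sphere (0 : E) 1) := integral_orthogonalMaps_inv_apply_eq μ f
          ((norm_eq_of_mem_sphere x).trans hv.symm)
        simp [this]

/-- If `Ff` at `g e` is the integral of `f` over the image of a unit sphere under `g ∘ L`, for every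
orthogonal map `g`, then the integral of `Ff` is that of `f` times the area of the smaller sphere. -/
theorem integral_toSphere_eq_of_orthogonal_orbit {F : Type*} [NormedAddCommGroup F]
    [InnerProductSpace ℝ F] [FiniteDimensional ℝ F] [MeasurableSpace F] [BorelSpace F]
    (L : F →ₗᵢ[ℝ] E) {e : E} (he : ‖e‖ = 1) {f Ff : E → ℝ} (hf : ContinuousOn f (sphere 0 1))
    (hFf : ∀ g : OrthogonalMaps E, Ff ((g : E →L[ℝ] E) e) =
      ∫ y : sphere (0 : F) 1, f ((g : E →L[ℝ] E) (L y)) ∂(volume : Measure F).toSphere) :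
    ∫ v : sphere (0 : E) 1, Ff v ∂(volume : Measure E).toSphere =
      (volume : Measure F).toSphere.real univ *
        ∫ x : sphere (0 : E) 1, f x ∂(volume : Measure E).toSphere := by
  let : MeasurableSpace (OrthogonalMaps E) := borel _
  have : BorelSpace (OrthogonalMaps E) := ⟨rfl⟩
  have := compactSpace_orthogonalMaps (E := E)
  let μ : Measure (OrthogonalMaps E) := Measure.haarMeasure ⊤
  have : IsProbabilityMeasure μ := ⟨Measure.haarMeasure_self⟩
  have hcont : Continuous fun p : OrthogonalMaps E × sphere (0 : F) 1 =>
      f ((p.1 : E →L[ℝ] E) (L p.2)) := by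
    refine hf.comp_continuous (Continuous.orthogonalMaps_apply (by fun_prop)
      (L.continuous.comp (by fun_prop))) fun p => ?_
    simp [Unitary.norm_map]
  have hFc : ContinuousOn Ff (sphere 0 1) := by
    let q : OrthogonalMaps E → sphere (0 : E) 1 :=
      fun g => ⟨(g : E →L[ℝ] E) e, by simp [Unitary.norm_map, he]⟩
    have hq : Continuous q :=
      (Continuous.orthogonalMaps_apply continuous_id continuous_const).subtype_mk _
    have hqs : Function.Surjective q := fun x =>
      (exists_orthogonalMaps_apply_eq (he.trans (norm_eq_of_mem_sphere x).symm)).imp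
        fun g hg => Subtype.ext hg
    rw [continuousOn_iff_continuous_domRestrict,
      (hq.isClosedMap.isQuotientMap hq hqs).continuous_iff]
    refine (continuous_congr hFf).mpr ?_
    simpa using continuous_parametric_integral_of_continuous
      (μ := (volume : Measure F).toSphere) hcont isCompact_univ
  have hL (y : sphere (0 : F) 1) : ‖L y‖ = 1 := by simp
  rw [integral_toSphere_eq_mul_integral_orthogonalMaps μ hFc he,
    integral_congr_ae (.of_forall fun g => hFf g⁻¹),
    integral_integral_swap_of_hasCompactSupport
      (f := fun (g : OrthogonalMaps E) (y : sphere (0 : F) 1) =>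
        f (((g⁻¹ : OrthogonalMaps E) : E →L[ℝ] E) (L y)))
      (hcont.comp ((continuous_fst.inv).prodMk continuous_snd))
      (HasCompactSupport.of_compactSpace _),
    integral_congr_ae (.of_forall fun y => integral_orthogonalMaps_inv_apply_eq μ f
      ((hL y).trans he.symm)),
    integral_toSphere_eq_mul_integral_orthogonalMaps μ hf he, integral_const, smul_eq_mul,
    mul_left_comm]

end OrthogonalAverage

/-- The total integral of the Funk transform:
`∫_{S^n} F(f) dσ_n = ω_{n−1}·∫_{S^n} f dσ_n` for a continuous function `f` on `S^n`.
Here `Ff` is the Funk transform of `f`: its value at a unit vector `v` is the integral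
of `f` over the equator `Σ_v`, realized through any linear isometry `L` of `ℝ^n`
onto `v^⊥` (the co-area identity used in the proof of Theorem B of the paper). -/
theorem funk_transform_total_integral
    (n : ℕ) (hn : 2 ≤ n)
    (f Ff : EuclideanSpace ℝ (Fin (n + 1)) → ℝ)
    (hf : ContinuousOn f (Metric.sphere (0 : EuclideanSpace ℝ (Fin (n + 1))) 1))
    (hFf : ∀ v : EuclideanSpace ℝ (Fin (n + 1)), ‖v‖ = 1 →
      ∀ L : EuclideanSpace ℝ (Fin n) →ₗᵢ[ℝ] EuclideanSpace ℝ (Fin (n + 1)),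
        LinearMap.range L.toLinearMap = (Submodule.span ℝ {v})ᗮ →
        Ff v = ∫ y : Metric.sphere (0 : EuclideanSpace ℝ (Fin n)) 1,
          f (L ↑y) ∂(sphereMeasure n)) :
    (∫ v : Metric.sphere (0 : EuclideanSpace ℝ (Fin (n + 1))) 1,
        Ff ↑v ∂(sphereMeasure (n + 1))) =
      sphereArea (n - 1) *
        ∫ x : Metric.sphere (0 : EuclideanSpace ℝ (Fin (n + 1))) 1,
          f ↑x ∂(sphereMeasure (n + 1)) := by
  have : Fact (finrank ℝ (EuclideanSpace ℝ (Fin (n + 1))) = n + 1) := ⟨finrank_euclideanSpace_fin⟩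
  obtain ⟨e, he⟩ := exists_norm_eq (EuclideanSpace ℝ (Fin (n + 1))) zero_le_one
  have he0 : e ≠ 0 := norm_ne_zero_iff.mp (by simp [he])
  let b := OrthonormalBasis.fromOrthogonalSpanSingleton (𝕜 := ℝ) n he0
  let L : EuclideanSpace ℝ (Fin n) →ₗᵢ[ℝ] EuclideanSpace ℝ (Fin (n + 1)) :=
    (Submodule.span ℝ {e})ᗮ.subtypeₗᵢ.comp b.repr.symm.toLinearIsometry
  have hL : LinearMap.range L.toLinearMap = (Submodule.span ℝ {e})ᗮ := by
    ext x
    constructor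
    · rintro ⟨y, rfl⟩
      exact (b.repr.symm y).property
    · exact fun hx => ⟨b.repr ⟨x, hx⟩, by simp [L]⟩
  have hmain := integral_toSphere_eq_of_orthogonal_orbit L he (Ff := Ff) hf fun g => by
    refine hFf _ ((Unitary.norm_map g e).trans he)
      ((Unitary.linearIsometryEquiv g).toLinearIsometry.comp L) ?_
    have hspan : Submodule.span ℝ {(g : _ →L[ℝ] _) e} = (Submodule.span ℝ {e}).map
        (Unitary.linearIsometryEquiv g).toLinearEquiv.toLinearMap := by
      rw [Submodule.map_span, image_singleton]
      rfl
    rw [hspan, ← Submodule.map_orthogonal_equiv, ← hL]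
    exact LinearMap.range_comp _ _
  rw [sphereArea, Nat.sub_add_cancel (by lia)]
  exact hmain
end

section
/- Let n ≥ 2, let f : S^n → ℝ be continuous, and let v ∈ S^n. Then the function u ↦ f(u)·(1 − ⟨u,v⟩²)^{−1/2} is integrable on (S^n, σ_n), and the iterated Funk transform satisfies F(F(f))(v) = ∫_{Σ_v} F(f)(y) dσ_v(y) = ω_{n−2} · ∫_{S^n} f(u)·(1 − ⟨u,v⟩²)^{−1/2} dσ_n(u). -/
open MeasureTheory
open scoped RealInnerProductSpace

open scoped ENNReal
open Set Measure Metric Filter Topology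

section Polar

variable {E : Type*} [NormedAddCommGroup E] [NormedSpace ℝ E]

/-- Integration in polar coordinates. -/
theorem lintegral_eq_lintegral_toSphere_volumeIoiPow [FiniteDimensional ℝ E] [Nontrivial E]
    [MeasurableSpace E] [BorelSpace E] (μ : Measure E) [μ.IsAddHaarMeasure]
    {h : E → ℝ≥0∞} (hh : Measurable h) :
    ∫⁻ x, h x ∂μ = ∫⁻ y, ∫⁻ r, h ((r : ℝ) • (y : E))
      ∂(volumeIoiPow (Module.finrank ℝ E - 1)) ∂μ.toSphere := by
  calc ∫⁻ x, h x ∂μ = ∫⁻ x : ({0}ᶜ : Set E), h x ∂(μ.comap (↑)) := by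
        rw [lintegral_subtype_comap (measurableSet_singleton _).compl h, restrict_compl_singleton]
    _ = ∫⁻ p, h ((p.2 : ℝ) • (p.1 : E))
          ∂(μ.toSphere.prod (volumeIoiPow (Module.finrank ℝ E - 1))) := by
        rw [← μ.measurePreserving_homeomorphUnitSphereProd.lintegral_comp_emb
          (Homeomorph.measurableEmbedding _)]
        refine lintegral_congr fun x => ?_
        congr 1
        have hx : ‖(x : E)‖ ≠ 0 := norm_ne_zero_iff.2 x.2
        simp [smul_smul, hx]
    _ = _ := lintegral_prod _ (by fun_prop)

theorem lintegral_volumeIoiPow_indicator_cone {B : Set E} (k : ℕ) {x : E} (hx : x ≠ 0) :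
    ∫⁻ r, {z : E | ‖z‖ < 1 ∧ ‖z‖⁻¹ • z ∈ B}.indicator (1 : E → ℝ≥0∞) ((r : ℝ) • x)
      ∂(volumeIoiPow k) =
    B.indicator (1 : E → ℝ≥0∞) (‖x‖⁻¹ • x) * ENNReal.ofReal (‖x‖⁻¹ ^ (k + 1)) *
      ENNReal.ofReal (1 / (k + 1)) := by
  have hx' : 0 < ‖x‖ := norm_pos_iff.2 hx
  have key : ∀ r : Ioi (0 : ℝ),
      {z : E | ‖z‖ < 1 ∧ ‖z‖⁻¹ • z ∈ B}.indicator (1 : E → ℝ≥0∞) ((r : ℝ) • x) =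
      B.indicator (1 : E → ℝ≥0∞) (‖x‖⁻¹ • x) *
        (Iio (⟨‖x‖⁻¹, inv_pos.2 hx'⟩ : Ioi (0 : ℝ))).indicator 1 r := by
    intro r
    have hr : (0 : ℝ) < r := r.2
    have e1 : ‖(r : ℝ) • x‖⁻¹ • (r : ℝ) • x = ‖x‖⁻¹ • x := by
      rw [norm_smul, smul_smul, Real.norm_of_nonneg hr.le]
      congr 1
      field_simp
    have e2 : ‖(r : ℝ) • x‖ < 1 ↔ r < (⟨‖x‖⁻¹, inv_pos.2 hx'⟩ : Ioi (0 : ℝ)) := by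
      rw [norm_smul, Real.norm_of_nonneg hr.le, ← lt_div_iff₀ hx', one_div]
      rfl
    by_cases h1 : ‖x‖⁻¹ • x ∈ B <;>
    by_cases h2 : r < (⟨‖x‖⁻¹, inv_pos.2 hx'⟩ : Ioi (0 : ℝ)) <;>
    simp [indicator, e1, e2, h1, h2]
  rw [lintegral_congr key, lintegral_const_mul _ (measurable_one.indicator measurableSet_Iio),
    lintegral_indicator_one measurableSet_Iio, volumeIoiPow_apply_Iio, mul_assoc,
    ← ENNReal.ofReal_mul (by positivity), mul_one_div]

theorem lintegral_ofReal_mul_volumeIoiPow (k : ℕ) {h : Ioi (0 : ℝ) → ℝ≥0∞} (hh : Measurable h) :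
    ∫⁻ r, ENNReal.ofReal r * h r ∂(volumeIoiPow k) = ∫⁻ r, h r ∂(volumeIoiPow (k + 1)) := by
  rw [volumeIoiPow, volumeIoiPow,
    lintegral_withDensity_eq_lintegral_mul _ (by fun_prop) (by fun_prop),
    lintegral_withDensity_eq_lintegral_mul _ (by fun_prop) (by fun_prop)]
  refine lintegral_congr fun r => ?_
  have hr : (0 : ℝ) < r := r.2
  simp only [Pi.mul_apply]
  rw [← mul_assoc, ← ENNReal.ofReal_mul (by positivity), pow_succ]

theorem ofReal_mul_lintegral_comp_mul_left {r : ℝ} (hr : 0 < r) (h : ℝ → ℝ≥0∞) :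
    ENNReal.ofReal r * ∫⁻ t, h (r * t) = ∫⁻ t, h t := by
  conv_rhs => rw [← Real.smul_map_volume_mul_left hr.ne', abs_of_pos hr]
  rw [lintegral_smul_measure, smul_eq_mul]
  congr 1
  exact ((Homeomorph.mulLeft₀ r hr.ne').measurableEmbedding.lintegral_map h).symm

end Polar

section Slice

variable {E F : Type*} [NormedAddCommGroup E] [InnerProductSpace ℝ E]
  [NormedAddCommGroup F] [InnerProductSpace ℝ F] {w : F} {L : E →ₗᵢ[ℝ] F}

theorem norm_smul_add_sq (hw : ‖w‖ = 1) (hwL : ∀ x, ⟪w, L x⟫ = 0) (t : ℝ) (x : E) :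
    ‖t • w + L x‖ ^ 2 = t ^ 2 + ‖x‖ ^ 2 := by
  rw [norm_add_sq_real, inner_smul_left, hwL, norm_smul, hw, L.norm_map]
  simp

theorem norm_smul_add_of_mem_sphere (hw : ‖w‖ = 1) (hwL : ∀ x, ⟪w, L x⟫ = 0) (t : ℝ)
    (y : sphere (0 : E) 1) : ‖t • w + L y‖ = √(1 + t ^ 2) := by
  rw [← Real.sqrt_sq (norm_nonneg _), norm_smul_add_sq hw hwL, norm_eq_of_mem_sphere, add_comm]
  simp

/-- The point of the unit sphere over `(t, y)` in the gnomonic parametrization of the sphere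
minus the poles `± w`. -/
noncomputable def sphereSlice (hw : ‖w‖ = 1) (hwL : ∀ x, ⟪w, L x⟫ = 0)
    (p : ℝ × sphere (0 : E) 1) : sphere (0 : F) 1 :=
  ⟨(√(1 + p.1 ^ 2))⁻¹ • (p.1 • w + L p.2), by
    have h : 0 < √(1 + p.1 ^ 2) := by positivity
    rw [mem_sphere_zero_iff_norm, norm_smul, norm_smul_add_of_mem_sphere hw hwL, norm_inv,
      Real.norm_of_nonneg h.le, inv_mul_cancel₀ h.ne']⟩

theorem continuous_sphereSlice (hw : ‖w‖ = 1) (hwL : ∀ x, ⟪w, L x⟫ = 0) :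
    Continuous (sphereSlice hw hwL) := by
  refine Continuous.subtype_mk (Continuous.smul (Continuous.inv₀ (by fun_prop) fun p => ?_)
    (by fun_prop)) _
  positivity

variable [FiniteDimensional ℝ E] [MeasurableSpace E] [BorelSpace E]
  [FiniteDimensional ℝ F] [MeasurableSpace F] [BorelSpace F]

/-- Orthogonal coordinates along a unit vector and its orthogonal hyperplane preserve volume. -/
theorem measurePreserving_smul_add (hw : ‖w‖ = 1) (hwL : ∀ x, ⟪w, L x⟫ = 0)
    (hdim : Module.finrank ℝ F = Module.finrank ℝ E + 1) :
    MeasurePreserving (fun p : ℝ × E => p.1 • w + L p.2) := by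
  let l : WithLp 2 (ℝ × E) →ₗ[ℝ] F :=
    ((LinearMap.toSpanSingleton ℝ F w).coprod L.toLinearMap) ∘ₗ
      (WithLp.linearEquiv 2 ℝ (ℝ × E)).toLinearMap
  have hl : ∀ p, ‖l p‖ = ‖p‖ := by
    intro p
    rw [← sq_eq_sq₀ (norm_nonneg _) (norm_nonneg _), WithLp.prod_norm_sq_eq_of_L2]
    simpa [l] using norm_smul_add_sq hw hwL p.fst p.snd
  let i : WithLp 2 (ℝ × E) ≃ₗᵢ[ℝ] F :=
    LinearIsometry.toLinearIsometryEquiv ⟨l, hl⟩ (by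
      rw [hdim, LinearEquiv.finrank_eq (WithLp.linearEquiv 2 ℝ (ℝ × E)), Module.finrank_prod,
        Module.finrank_self, add_comm])
  exact i.measurePreserving.comp (WithLp.volume_preserving_toLp ℝ E)

/-- The first factor of the surface measure in the gnomonic parametrization. -/
noncomputable def sliceMeasure (m : ℕ) : Measure ℝ :=
  volume.withDensity fun t => ENNReal.ofReal ((√(1 + t ^ 2))⁻¹ ^ (m + 1))

instance (m : ℕ) : SFinite (sliceMeasure m) := by
  unfold sliceMeasure
  infer_instance

theorem toSphere_eq_map_sphereSlice [Nontrivial E] (hw : ‖w‖ = 1) (hwL : ∀ x, ⟪w, L x⟫ = 0)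
    (hdim : Module.finrank ℝ F = Module.finrank ℝ E + 1) :
    (volume : Measure F).toSphere =
      ((sliceMeasure (Module.finrank ℝ E)).prod (volume : Measure E).toSphere).map
        (sphereSlice hw hwL) := by
  set m := Module.finrank ℝ E
  have hmpos : 0 < m := Module.finrank_pos
  have : Nontrivial F := Module.nontrivial_of_finrank_pos (R := ℝ) (by omega)
  have hmeas := (continuous_sphereSlice hw hwL).measurable
  ext A ⟨B, hB, hBA⟩
  have hA : MeasurableSet A := ⟨B, hB, hBA⟩
  set C : Set F := {z : F | ‖z‖ < 1 ∧ ‖z‖⁻¹ • z ∈ B} with hC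
  have hCm : MeasurableSet C :=
    (measurableSet_lt measurable_norm measurable_const).inter
      ((by fun_prop : Measurable fun z : F => ‖z‖⁻¹ • z) hB)
  have hCi : Measurable (C.indicator (1 : F → ℝ≥0∞)) := measurable_one.indicator hCm
  set c : ℝ≥0∞ := ENNReal.ofReal (1 / (m + 1)) with hc
  have hc0 : c ≠ 0 := by simp only [hc, ne_eq, ENNReal.ofReal_eq_zero, not_le]; positivity
  have left : volume C = volume.toSphere A * c := by
    rw [← lintegral_indicator_one hCm, lintegral_eq_lintegral_toSphere_volumeIoiPow _ hCi,
      ← lintegral_indicator_one hA, ← lintegral_mul_const _ (measurable_one.indicator hA), hdim]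
    refine lintegral_congr fun y => ?_
    have hy : (y : F) ≠ 0 := ne_zero_of_mem_unit_sphere y
    rw [Nat.add_sub_cancel, hC, lintegral_volumeIoiPow_indicator_cone m hy, ← hBA]
    rw [show ‖(y : F)‖ = 1 from norm_eq_of_mem_sphere y, inv_one, one_smul, one_pow,
      ENNReal.ofReal_one, mul_one]
    rfl
  have right : volume C = ((sliceMeasure m).prod (volume : Measure E).toSphere).map
      (sphereSlice hw hwL) A * c := by
    rw [map_apply hmeas hA, ← lintegral_indicator_one hCm,
      ← (measurePreserving_smul_add hw hwL hdim).lintegral_comp hCi, volume_eq_prod,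
      lintegral_prod_symm _ (by fun_prop),
      lintegral_eq_lintegral_toSphere_volumeIoiPow _ (by fun_prop)]
    rw [← lintegral_indicator_one (hmeas hA),
      lintegral_prod_symm _ (measurable_one.indicator (hmeas hA)).aemeasurable,
      ← lintegral_mul_const' _ _ ENNReal.ofReal_ne_top]
    refine lintegral_congr fun y => ?_
    have hmeasC : Measurable fun p : ℝ × Ioi (0 : ℝ) =>
        C.indicator (1 : F → ℝ≥0∞) ((p.2 : ℝ) • (p.1 • w + L y)) := by fun_prop
    have hslice : Measurable fun t : ℝ =>
        (sphereSlice hw hwL ⁻¹' A).indicator (1 : ℝ × sphere (0 : E) 1 → ℝ≥0∞) (t, y) :=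
      (measurable_one.indicator (hmeas hA)).comp measurable_prodMk_right
    have step (r : Ioi (0 : ℝ)) :
        ∫⁻ t : ℝ, C.indicator (1 : F → ℝ≥0∞) (t • w + L ((r : ℝ) • (y : E))) =
          ENNReal.ofReal r *
            ∫⁻ t : ℝ, C.indicator (1 : F → ℝ≥0∞) ((r : ℝ) • (t • w + L y)) := by
      rw [← ofReal_mul_lintegral_comp_mul_left r.2]
      simp only [smul_add, smul_smul, map_smul]
    rw [lintegral_congr step,
      lintegral_ofReal_mul_volumeIoiPow _ hmeasC.lintegral_prod_left',
      Nat.sub_add_cancel hmpos, lintegral_lintegral_swap (by fun_prop), sliceMeasure,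
      lintegral_withDensity_eq_lintegral_mul _ (by fun_prop) hslice,
      ← lintegral_mul_const' _ _ ENNReal.ofReal_ne_top]
    refine lintegral_congr fun t => ?_
    have hnorm := norm_smul_add_of_mem_sphere hw hwL t y
    have hne : t • w + L y ≠ 0 := by
      rw [← norm_pos_iff, hnorm]
      positivity
    rw [hC, lintegral_volumeIoiPow_indicator_cone m hne, hnorm, ← hBA, Pi.mul_apply,
      mul_comm (B.indicator _ _)]
    rfl
  exact (ENNReal.mul_left_inj hc0 ENNReal.ofReal_ne_top).1 (left.symm.trans right)

theorem integral_toSphere_eq_integral_sphereSlice [Nontrivial E] (hw : ‖w‖ = 1)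
    (hwL : ∀ x, ⟪w, L x⟫ = 0) (hdim : Module.finrank ℝ F = Module.finrank ℝ E + 1)
    {f : sphere (0 : F) 1 → ℝ} (hf : AEStronglyMeasurable f (volume : Measure F).toSphere) :
    ∫ u, f u ∂(volume : Measure F).toSphere = ∫ p, f (sphereSlice hw hwL p)
      ∂((sliceMeasure (Module.finrank ℝ E)).prod (volume : Measure E).toSphere) := by
  rw [toSphere_eq_map_sphereSlice hw hwL hdim] at hf ⊢
  exact integral_map (continuous_sphereSlice hw hwL).aemeasurable hf

theorem integrable_toSphere_iff_sphereSlice [Nontrivial E] (hw : ‖w‖ = 1)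
    (hwL : ∀ x, ⟪w, L x⟫ = 0) (hdim : Module.finrank ℝ F = Module.finrank ℝ E + 1)
    {f : sphere (0 : F) 1 → ℝ} (hf : AEStronglyMeasurable f (volume : Measure F).toSphere) :
    Integrable f (volume : Measure F).toSphere ↔ Integrable (fun p => f (sphereSlice hw hwL p))
      ((sliceMeasure (Module.finrank ℝ E)).prod (volume : Measure E).toSphere) := by
  rw [toSphere_eq_map_sphereSlice hw hwL hdim] at hf ⊢
  exact integrable_map_measure hf (continuous_sphereSlice hw hwL).aemeasurable

end Slice

section Kernel

/-- The Cauchy kernel, pulled back to the gnomonic coordinate and rescaled. -/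
noncomputable def sliceKernel (m : ℕ) (ε s : ℝ) : ℝ :=
  (√(1 + (ε * s) ^ 2))⁻¹ ^ (m + 1) * ((1 + (ε * s) ^ 2) / (1 + (ε * s) ^ 2 + s ^ 2))

theorem continuous_sliceKernel (m : ℕ) : Continuous fun p : ℝ × ℝ => sliceKernel m p.1 p.2 := by
  unfold sliceKernel
  refine Continuous.mul (Continuous.pow (Continuous.inv₀ (by fun_prop) fun p => ?_) _)
    (Continuous.div (by fun_prop) (by fun_prop) fun p => ?_) <;> positivity

theorem sliceKernel_nonneg (m : ℕ) (ε s : ℝ) : 0 ≤ sliceKernel m ε s := by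
  unfold sliceKernel
  positivity

theorem sliceKernel_zero (m : ℕ) (s : ℝ) : sliceKernel m 0 s = (1 + s ^ 2)⁻¹ := by
  simp [sliceKernel]

theorem inv_sqrt_one_add_sq_pow_le {m : ℕ} (hm : 2 ≤ m) (t : ℝ) :
    (√(1 + t ^ 2))⁻¹ ^ m ≤ (1 + t ^ 2)⁻¹ := by
  have h1 : 1 ≤ √(1 + t ^ 2) := Real.one_le_sqrt.2 (by nlinarith [sq_nonneg t])
  calc (√(1 + t ^ 2))⁻¹ ^ m ≤ (√(1 + t ^ 2))⁻¹ ^ 2 :=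
        pow_le_pow_of_le_one (by positivity) (inv_le_one_of_one_le₀ h1) hm
    _ = (1 + t ^ 2)⁻¹ := by rw [inv_pow, Real.sq_sqrt (by positivity)]

theorem sliceKernel_le {m : ℕ} (hm : 1 ≤ m) (ε s : ℝ) : sliceKernel m ε s ≤ (1 + s ^ 2)⁻¹ := by
  calc sliceKernel m ε s
      ≤ (1 + (ε * s) ^ 2)⁻¹ * ((1 + (ε * s) ^ 2) / (1 + (ε * s) ^ 2 + s ^ 2)) :=
        mul_le_mul_of_nonneg_right (inv_sqrt_one_add_sq_pow_le (by omega) _) (by positivity)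
    _ = (1 + (ε * s) ^ 2 + s ^ 2)⁻¹ := by field_simp
    _ ≤ (1 + s ^ 2)⁻¹ := inv_anti₀ (by positivity) (by nlinarith [sq_nonneg (ε * s)])

theorem integrable_sliceKernel {m : ℕ} (hm : 1 ≤ m) (ε : ℝ) : Integrable (sliceKernel m ε) :=
  integrable_inv_one_add_sq.mono'
    ((continuous_sliceKernel m).comp (Continuous.prodMk_right ε)).aestronglyMeasurable
    (.of_forall fun s => by
      rw [Real.norm_of_nonneg (sliceKernel_nonneg _ _ _)]; exact sliceKernel_le hm ε s)

theorem integral_sliceKernel_le {m : ℕ} (hm : 1 ≤ m) (ε : ℝ) :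
    ∫ s, sliceKernel m ε s ≤ Real.pi := by
  rw [← integral_univ_inv_one_add_sq]
  exact integral_mono (integrable_sliceKernel hm ε) integrable_inv_one_add_sq (sliceKernel_le hm ε)

theorem tendsto_integral_sliceKernel_mul {m : ℕ} (hm : 1 ≤ m) {G : ℝ → ℝ} (hG : Continuous G)
    {C : ℝ} (hC : ∀ t, |G t| ≤ C) :
    Tendsto (fun ε => ∫ s, sliceKernel m ε s * G (ε * s)) (𝓝 0) (𝓝 (Real.pi * G 0)) := by
  have hk := continuous_sliceKernel m
  have hlim : ∫ s : ℝ, (1 + s ^ 2)⁻¹ * G 0 = Real.pi * G 0 := by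
    rw [integral_mul_const, integral_univ_inv_one_add_sq]
  rw [← hlim]
  refine tendsto_integral_filter_of_dominated_convergence (fun s => (1 + s ^ 2)⁻¹ * C)
    (.of_forall fun ε => ?_) (.of_forall fun ε => .of_forall fun s => ?_)
    (integrable_inv_one_add_sq.mul_const C) (.of_forall fun s => ?_)
  · exact ((hk.comp (Continuous.prodMk_right ε)).mul
      (hG.comp (continuous_const_mul ε))).aestronglyMeasurable
  · rw [norm_mul, Real.norm_of_nonneg (sliceKernel_nonneg _ _ _)]
    exact mul_le_mul (sliceKernel_le hm ε s) (hC _) (abs_nonneg _) (by positivity)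
  · have h : Continuous fun ε => sliceKernel m ε s * G (ε * s) :=
      (hk.comp (Continuous.prodMk_left s)).mul (hG.comp (continuous_mul_const s))
    simpa [sliceKernel_zero] using h.tendsto 0

theorem integral_sliceMeasure (m : ℕ) (g : ℝ → ℝ) :
    ∫ t, g t ∂(sliceMeasure m) = ∫ t, (√(1 + t ^ 2))⁻¹ ^ (m + 1) * g t := by
  rw [sliceMeasure, integral_withDensity_eq_integral_toReal_smul (by fun_prop) (by simp)]
  refine integral_congr_ae (.of_forall fun t => ?_)
  simp only [smul_eq_mul]
  rw [ENNReal.toReal_ofReal (by positivity)]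

theorem integral_sliceMeasure_cauchy (m : ℕ) {ε : ℝ} (hε : 0 < ε) (G : ℝ → ℝ) :
    ∫ t, ε / (ε ^ 2 + (t / √(1 + t ^ 2)) ^ 2) * G t ∂(sliceMeasure m) =
      ∫ s, sliceKernel m ε s * G (ε * s) := by
  have h := Measure.integral_comp_mul_left (fun t => (√(1 + t ^ 2))⁻¹ ^ (m + 1) *
    (ε / (ε ^ 2 + (t / √(1 + t ^ 2)) ^ 2) * G t)) ε
  rw [abs_of_pos (inv_pos.2 hε), smul_eq_mul, eq_inv_mul_iff_mul_eq₀ hε.ne'] at h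
  rw [integral_sliceMeasure, ← h, ← integral_const_mul]
  refine integral_congr_ae (.of_forall fun s => ?_)
  simp only [sliceKernel, div_pow]
  rw [Real.sq_sqrt (by positivity)]
  field_simp

end Kernel

section CauchyTransform

variable {E F : Type*} [NormedAddCommGroup E] [InnerProductSpace ℝ E]
  [NormedAddCommGroup F] [InnerProductSpace ℝ F] {w : F} {L : E →ₗᵢ[ℝ] F}

theorem inner_sphereSlice (hw : ‖w‖ = 1) (hwL : ∀ x, ⟪w, L x⟫ = 0)
    (p : ℝ × sphere (0 : E) 1) :
    ⟪(sphereSlice hw hwL p : F), w⟫ = p.1 / √(1 + p.1 ^ 2) := by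
  rw [real_inner_comm]
  simp [sphereSlice, inner_add_right, inner_smul_right, hwL, hw, div_eq_inv_mul]

theorem inner_sphereSlice_map (hw : ‖w‖ = 1) (hwL : ∀ x, ⟪w, L x⟫ = 0)
    (p : ℝ × sphere (0 : E) 1) (x : E) :
    ⟪(sphereSlice hw hwL p : F), L x⟫ = ⟪x, (p.2 : E)⟫ / √(1 + p.1 ^ 2) := by
  simp [sphereSlice, inner_add_left, inner_smul_left, hwL, div_eq_inv_mul, real_inner_comm]

theorem sphereSlice_zero (hw : ‖w‖ = 1) (hwL : ∀ x, ⟪w, L x⟫ = 0) (y : sphere (0 : E) 1) :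
    (sphereSlice hw hwL (0, y) : F) = L y := by
  simp [sphereSlice]

theorem inner_eq_zero_of_range_eq (h : LinearMap.range L.toLinearMap = (Submodule.span ℝ {w})ᗮ)
    (x : E) : ⟪w, L x⟫ = 0 :=
  (Submodule.mem_orthogonal_singleton_iff_inner_right).1 (h ▸ LinearMap.mem_range_self _ x)

theorem continuous_cauchy {ε : ℝ} (hε : 0 < ε) : Continuous fun t : ℝ => ε / (ε ^ 2 + t ^ 2) :=
  Continuous.div (by fun_prop) (by fun_prop) fun t => by positivity

variable [FiniteDimensional ℝ E] [MeasurableSpace E] [BorelSpace E]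

theorem continuous_integral_sphereSlice (hw : ‖w‖ = 1) (hwL : ∀ x, ⟪w, L x⟫ = 0)
    {f : sphere (0 : F) 1 → ℝ} (hf : Continuous f) :
    Continuous fun t : ℝ =>
      ∫ y, f (sphereSlice hw hwL (t, y)) ∂(volume : Measure E).toSphere := by
  have := isCompact_univ (X := sphere (0 : E) 1)
  simpa using continuous_parametric_integral_of_continuous
    (μ := (volume : Measure E).toSphere)
    (f := fun t y => f (sphereSlice hw hwL (t, y)))
    (hf.comp (continuous_sphereSlice hw hwL)) this

theorem abs_integral_sphereSlice_le (hw : ‖w‖ = 1) (hwL : ∀ x, ⟪w, L x⟫ = 0)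
    {f : sphere (0 : F) 1 → ℝ} {M : ℝ} (hM : ∀ u, |f u| ≤ M) (t : ℝ) :
    |∫ y, f (sphereSlice hw hwL (t, y)) ∂(volume : Measure E).toSphere| ≤
      M * (volume : Measure E).toSphere.real univ :=
  norm_integral_le_of_norm_le_const (μ := (volume : Measure E).toSphere)
    (f := fun y => f (sphereSlice hw hwL (t, y))) (.of_forall fun _ => hM _)

variable [FiniteDimensional ℝ F] [MeasurableSpace F] [BorelSpace F]

theorem integral_toSphere_cauchy_mul [Nontrivial E] (hw : ‖w‖ = 1) (hwL : ∀ x, ⟪w, L x⟫ = 0)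
    (hdim : Module.finrank ℝ F = Module.finrank ℝ E + 1) {f : sphere (0 : F) 1 → ℝ}
    (hf : Continuous f) {ε : ℝ} (hε : 0 < ε) :
    ∫ u, ε / (ε ^ 2 + ⟪(u : F), w⟫ ^ 2) * f u ∂(volume : Measure F).toSphere =
      ∫ s, sliceKernel (Module.finrank ℝ E) ε s *
        ∫ y, f (sphereSlice hw hwL (ε * s, y)) ∂(volume : Measure E).toSphere := by
  have hcont : Continuous fun u : sphere (0 : F) 1 => ε / (ε ^ 2 + ⟪(u : F), w⟫ ^ 2) * f u :=
    ((continuous_cauchy hε).comp (by fun_prop : Continuous fun u : sphere (0 : F) 1 =>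
      ⟪(u : F), w⟫)).mul hf
  have hint : Integrable (fun u : sphere (0 : F) 1 => ε / (ε ^ 2 + ⟪(u : F), w⟫ ^ 2) * f u)
      (volume : Measure F).toSphere :=
    hcont.integrable_of_hasCompactSupport (.of_compactSpace _)
  rw [integral_toSphere_eq_integral_sphereSlice hw hwL hdim hint.aestronglyMeasurable,
    integral_prod _ ((integrable_toSphere_iff_sphereSlice hw hwL hdim
      hint.aestronglyMeasurable).1 hint),
    ← integral_sliceMeasure_cauchy _ hε
      fun t => ∫ y, f (sphereSlice hw hwL (t, y)) ∂(volume : Measure E).toSphere]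
  refine integral_congr_ae (.of_forall fun t => ?_)
  simp only [inner_sphereSlice]
  exact integral_const_mul _ _

theorem integral_toSphere_cauchy [Nontrivial E] (hw : ‖w‖ = 1) (hwL : ∀ x, ⟪w, L x⟫ = 0)
    (hdim : Module.finrank ℝ F = Module.finrank ℝ E + 1) {ε : ℝ} (hε : 0 < ε) :
    ∫ u : sphere (0 : F) 1, ε / (ε ^ 2 + ⟪(u : F), w⟫ ^ 2) ∂(volume : Measure F).toSphere =
      (volume : Measure E).toSphere.real univ *
        ∫ s, sliceKernel (Module.finrank ℝ E) ε s := by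
  have h := integral_toSphere_cauchy_mul hw hwL hdim (f := fun _ => 1) continuous_const hε
  simp only [mul_one, integral_const, smul_eq_mul, integral_mul_const] at h
  rw [h, mul_comm]

theorem abs_integral_toSphere_cauchy_mul_le [Nontrivial E] (hw : ‖w‖ = 1)
    (hwL : ∀ x, ⟪w, L x⟫ = 0) (hdim : Module.finrank ℝ F = Module.finrank ℝ E + 1)
    {f : sphere (0 : F) 1 → ℝ} (hf : Continuous f) {M : ℝ} (hM : ∀ u, |f u| ≤ M)
    {ε : ℝ} (hε : 0 < ε) :
    |∫ u, ε / (ε ^ 2 + ⟪(u : F), w⟫ ^ 2) * f u ∂(volume : Measure F).toSphere| ≤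
      Real.pi * (M * (volume : Measure E).toSphere.real univ) := by
  have hm : 1 ≤ Module.finrank ℝ E := Module.finrank_pos
  rw [integral_toSphere_cauchy_mul hw hwL hdim hf hε, ← integral_univ_inv_one_add_sq,
    ← integral_mul_const, ← Real.norm_eq_abs]
  refine norm_integral_le_of_norm_le (integrable_inv_one_add_sq.mul_const _)
    (.of_forall fun s => ?_)
  rw [norm_mul, Real.norm_of_nonneg (sliceKernel_nonneg _ _ _)]
  exact mul_le_mul (sliceKernel_le hm ε s) (abs_integral_sphereSlice_le hw hwL hM _)
    (abs_nonneg _) (by positivity)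

theorem tendsto_integral_toSphere_cauchy_mul [Nontrivial E] (hw : ‖w‖ = 1)
    (hwL : ∀ x, ⟪w, L x⟫ = 0) (hdim : Module.finrank ℝ F = Module.finrank ℝ E + 1)
    {f : sphere (0 : F) 1 → ℝ} (hf : Continuous f) {M : ℝ} (hM : ∀ u, |f u| ≤ M) :
    Tendsto (fun ε : ℝ =>
        ∫ u, ε / (ε ^ 2 + ⟪(u : F), w⟫ ^ 2) * f u ∂(volume : Measure F).toSphere)
      (𝓝[>] 0)
      (𝓝 (Real.pi * ∫ y, f (sphereSlice hw hwL (0, y)) ∂(volume : Measure E).toSphere)) := by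
  have hm : 1 ≤ Module.finrank ℝ E := Module.finrank_pos
  refine ((tendsto_integral_sliceKernel_mul hm (continuous_integral_sphereSlice hw hwL hf)
    (abs_integral_sphereSlice_le hw hwL hM)).mono_left nhdsWithin_le_nhds).congr' ?_
  filter_upwards [self_mem_nhdsWithin] with ε hε
  exact (integral_toSphere_cauchy_mul hw hwL hdim hf hε).symm

end CauchyTransform

theorem exists_linearIsometry_range_eq_orthogonal {n : ℕ} {w : EuclideanSpace ℝ (Fin (n + 1))}
    (hw : w ≠ 0) :
    ∃ L : EuclideanSpace ℝ (Fin n) →ₗᵢ[ℝ] EuclideanSpace ℝ (Fin (n + 1)),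
      LinearMap.range L.toLinearMap = (Submodule.span ℝ {w})ᗮ := by
  have : Fact (Module.finrank ℝ (EuclideanSpace ℝ (Fin (n + 1))) = n + 1) :=
    ⟨finrank_euclideanSpace_fin⟩
  let e := (OrthonormalBasis.fromOrthogonalSpanSingleton (𝕜 := ℝ) n hw).repr.symm
  refine ⟨(Submodule.subtypeₗᵢ _).comp e.toLinearIsometry, ?_⟩
  ext x
  constructor
  · rintro ⟨y, rfl⟩
    exact (e y).2
  · intro hx
    exact ⟨e.symm ⟨x, hx⟩, by simp⟩

theorem integrable_sqrt_one_add_sq_sliceMeasure {m : ℕ} (hm : 2 ≤ m) :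
    Integrable (fun t : ℝ => √(1 + t ^ 2)) (sliceMeasure m) := by
  rw [sliceMeasure, integrable_withDensity_iff_integrable_smul' (by fun_prop) (by simp)]
  refine integrable_inv_one_add_sq.mono' (by fun_prop) (.of_forall fun t => ?_)
  have h : 0 < √(1 + t ^ 2) := by positivity
  rw [ENNReal.toReal_ofReal (by positivity), smul_eq_mul, pow_succ, mul_assoc,
    inv_mul_cancel₀ h.ne', mul_one, Real.norm_of_nonneg (by positivity)]
  exact inv_sqrt_one_add_sq_pow_le hm t

theorem one_sub_sq_div_sqrt_rpow (t : ℝ) :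
    (1 - (t / √(1 + t ^ 2)) ^ 2) ^ (-(1 / 2) : ℝ) = √(1 + t ^ 2) := by
  have h : 1 - (t / √(1 + t ^ 2)) ^ 2 = (1 + t ^ 2)⁻¹ := by
    rw [div_pow, Real.sq_sqrt (by positivity)]
    field_simp
    ring
  rw [h, Real.inv_rpow (by positivity), Real.rpow_neg (by positivity), inv_inv,
    Real.sqrt_eq_rpow]

theorem cauchy_div {R : ℝ} (hR : 0 < R) (ε t : ℝ) :
    ε / (ε ^ 2 + (t / R) ^ 2) = R * (ε * R / ((ε * R) ^ 2 + t ^ 2)) := by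
  field_simp

theorem tendsto_integral_sliceMeasure_prod {X : Type*} [MeasurableSpace X] [TopologicalSpace X]
    [OpensMeasurableSpace X] [SecondCountableTopology X] (ν : Measure X) [IsFiniteMeasure ν]
    {m k : ℕ} (hm : 2 ≤ m) (hk : 1 ≤ k) {g : ℝ × X → ℝ} (hg : Continuous g) {M : ℝ}
    (hM : ∀ p, |g p| ≤ M) :
    Integrable (fun p : ℝ × X => g p * √(1 + p.1 ^ 2)) ((sliceMeasure m).prod ν) ∧
    Tendsto (fun ε : ℝ => ∫ p : ℝ × X, g p * (√(1 + p.1 ^ 2) *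
        ∫ s, sliceKernel k (ε * √(1 + p.1 ^ 2)) s) ∂((sliceMeasure m).prod ν))
      (𝓝 0) (𝓝 (Real.pi * ∫ p : ℝ × X, g p * √(1 + p.1 ^ 2) ∂((sliceMeasure m).prod ν))) := by
  have hB : Continuous fun ε => ∫ s, sliceKernel k ε s :=
    continuous_of_dominated
      (fun ε => (integrable_sliceKernel hk ε).aestronglyMeasurable)
      (fun ε => .of_forall fun s => by
        rw [Real.norm_of_nonneg (sliceKernel_nonneg _ _ _)]
        exact sliceKernel_le hk ε s)
      integrable_inv_one_add_sq
      (.of_forall fun s => (continuous_sliceKernel k).comp (Continuous.prodMk_left s))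
  have hB0 : ∫ s, sliceKernel k 0 s = Real.pi := by
    simp only [sliceKernel_zero, integral_univ_inv_one_add_sq]
  have hR : Integrable (fun p : ℝ × X => √(1 + p.1 ^ 2)) ((sliceMeasure m).prod ν) :=
    (integrable_sqrt_one_add_sq_sliceMeasure hm).comp_fst ν
  have hint : Integrable (fun p : ℝ × X => g p * √(1 + p.1 ^ 2)) ((sliceMeasure m).prod ν) :=
    hR.bdd_mul hg.aestronglyMeasurable (.of_forall hM)
  refine ⟨hint, ?_⟩
  rw [← integral_const_mul]
  refine tendsto_integral_filter_of_dominated_convergence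
    (fun p => M * (√(1 + p.1 ^ 2) * Real.pi)) (.of_forall fun ε => ?_)
    (.of_forall fun ε => .of_forall fun p => ?_) ((hR.mul_const _).const_mul _)
    (.of_forall fun p => ?_)
  · exact (hg.mul ((by fun_prop : Continuous fun p : ℝ × X => √(1 + p.1 ^ 2)).mul
      (hB.comp (by fun_prop)))).aestronglyMeasurable
  · have h0 : 0 ≤ ∫ s, sliceKernel k (ε * √(1 + p.1 ^ 2)) s :=
      integral_nonneg (sliceKernel_nonneg _ _)
    rw [norm_mul, Real.norm_of_nonneg (by positivity : 0 ≤ √(1 + p.1 ^ 2) *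
      ∫ s, sliceKernel k (ε * √(1 + p.1 ^ 2)) s)]
    exact mul_le_mul (hM p) (mul_le_mul_of_nonneg_left (integral_sliceKernel_le hk _)
      (by positivity)) (by positivity) ((abs_nonneg _).trans (hM p))
  · have h : Continuous fun ε => g p * (√(1 + p.1 ^ 2) *
        ∫ s, sliceKernel k (ε * √(1 + p.1 ^ 2)) s) :=
      continuous_const.mul (continuous_const.mul (hB.comp (by fun_prop)))
    have := h.tendsto 0
    rw [zero_mul, hB0] at this
    convert! this using 2
    ring

instance (n : ℕ) : IsFiniteMeasure (sphereMeasure n) := by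
  unfold sphereMeasure
  infer_instance

/-- The iterated Funk transform as an integral operator with kernel
`ω_{n−2}·(1 − ⟨u,v⟩²)^{−1/2}`: the function `u ↦ f(u)·(1 − ⟨u,v⟩²)^{−1/2}` is
integrable on `S^n`, and `F(F(f))(v) = ∫_{Σ_v} F(f) dσ_v
= ω_{n−2}·∫_{S^n} f(u)·(1 − ⟨u,v⟩²)^{−1/2} dσ_n(u)`.  Here `Ff` is the Funk
transform of the continuous function `f`, and integration over the equator `Σ_v`
is realized through any linear isometry `L` of `ℝ^n` onto `v^⊥`
(Proposition 8.3 and Corollary A.2 of the paper, case `ρ = 0`, `Φ = 0`). -/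
theorem funk_transform_iterated
    (n : ℕ) (hn : 2 ≤ n)
    (f Ff : EuclideanSpace ℝ (Fin (n + 1)) → ℝ)
    (hf : ContinuousOn f (Metric.sphere (0 : EuclideanSpace ℝ (Fin (n + 1))) 1))
    (hFf : ∀ w : EuclideanSpace ℝ (Fin (n + 1)), ‖w‖ = 1 →
      ∀ L : EuclideanSpace ℝ (Fin n) →ₗᵢ[ℝ] EuclideanSpace ℝ (Fin (n + 1)),
        LinearMap.range L.toLinearMap = (Submodule.span ℝ {w})ᗮ →
        Ff w = ∫ y : Metric.sphere (0 : EuclideanSpace ℝ (Fin n)) 1,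
          f (L ↑y) ∂(sphereMeasure n))
    (v : EuclideanSpace ℝ (Fin (n + 1))) (hv : ‖v‖ = 1)
    (L : EuclideanSpace ℝ (Fin n) →ₗᵢ[ℝ] EuclideanSpace ℝ (Fin (n + 1)))
    (hL : LinearMap.range L.toLinearMap = (Submodule.span ℝ {v})ᗮ) :
    Integrable
      (fun u : Metric.sphere (0 : EuclideanSpace ℝ (Fin (n + 1))) 1 =>
        f ↑u * (1 - ⟪(↑u : EuclideanSpace ℝ (Fin (n + 1))), v⟫ ^ 2) ^ (-(1 / 2) : ℝ))
      (sphereMeasure (n + 1)) ∧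
    (∫ y : Metric.sphere (0 : EuclideanSpace ℝ (Fin n)) 1,
        Ff (L ↑y) ∂(sphereMeasure n)) =
      sphereArea (n - 2) *
        ∫ u : Metric.sphere (0 : EuclideanSpace ℝ (Fin (n + 1))) 1,
          f ↑u * (1 - ⟪(↑u : EuclideanSpace ℝ (Fin (n + 1))), v⟫ ^ 2) ^ (-(1 / 2) : ℝ)
          ∂(sphereMeasure (n + 1)) := by
  obtain ⟨k, rfl⟩ : ∃ k, n = k + 2 := ⟨n - 2, by omega⟩
  rw [Nat.add_sub_cancel]
  have hvL := inner_eq_zero_of_range_eq hL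
  have hdim : Module.finrank ℝ (EuclideanSpace ℝ (Fin (k + 2 + 1))) =
      Module.finrank ℝ (EuclideanSpace ℝ (Fin (k + 2))) + 1 := by simp
  set g : sphere (0 : EuclideanSpace ℝ (Fin (k + 2 + 1))) 1 → ℝ := fun u => f u with hg_def
  have hg : Continuous g := continuousOn_iff_continuous_domRestrict.1 hf
  obtain ⟨M, hM⟩ : ∃ M, ∀ u, |g u| ≤ M := by
    obtain ⟨M, hM⟩ := isCompact_univ.exists_bound_of_continuousOn hg.continuousOn
    exact ⟨M, fun u => hM u (mem_univ u)⟩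
  have hslice := continuous_sphereSlice hv hvL
  obtain ⟨hint, hlim⟩ := tendsto_integral_sliceMeasure_prod (sphereMeasure (k + 2))
    (m := k + 2) (k := k + 1) (by omega) (by omega) (hg.comp hslice) (M := M) fun p => hM _
  have hmeas : AEStronglyMeasurable (fun u : sphere (0 : EuclideanSpace ℝ (Fin (k + 2 + 1))) 1 =>
      g u * (1 - ⟪(↑u : EuclideanSpace ℝ (Fin (k + 2 + 1))), v⟫ ^ 2) ^ (-(1 / 2) : ℝ))
      (sphereMeasure (k + 2 + 1)) := by
    have hgm := hg.measurable
    exact (by fun_prop : Measurable _).aestronglyMeasurable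
  have hpull (p : ℝ × sphere (0 : EuclideanSpace ℝ (Fin (k + 2))) 1) :
      g (sphereSlice hv hvL p) * (1 - ⟪(sphereSlice hv hvL p :
        EuclideanSpace ℝ (Fin (k + 2 + 1))), v⟫ ^ 2) ^ (-(1 / 2) : ℝ) =
      (g ∘ sphereSlice hv hvL) p * √(1 + p.1 ^ 2) := by
    rw [inner_sphereSlice, one_sub_sq_div_sqrt_rpow, Function.comp_apply]
  have hfin : Module.finrank ℝ (EuclideanSpace ℝ (Fin (k + 2))) = k + 2 := by simp
  have hfin' : Module.finrank ℝ (EuclideanSpace ℝ (Fin (k + 1))) = k + 1 := by simp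
  refine ⟨?_, ?_⟩
  · refine (integrable_toSphere_iff_sphereSlice hv hvL hdim hmeas).2 ?_
    simp only [hpull, hfin]
    exact hint
  have hcont {ε : ℝ} (hε : 0 < ε) : Continuous fun p :
      sphere (0 : EuclideanSpace ℝ (Fin (k + 2))) 1 ×
        sphere (0 : EuclideanSpace ℝ (Fin (k + 2 + 1))) 1 =>
      ε / (ε ^ 2 + ⟪(p.2 : EuclideanSpace ℝ (Fin (k + 2 + 1))), L p.1⟫ ^ 2) * g p.2 :=
    ((continuous_cauchy hε).comp (by fun_prop)).mul (hg.comp continuous_snd)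
  have hprod {ε : ℝ} (hε : 0 < ε) :=
    (hcont hε).integrable_of_hasCompactSupport (.of_compactSpace _)
      (μ := (sphereMeasure (k + 2)).prod (sphereMeasure (k + 2 + 1)))
  have hleft : Tendsto (fun ε : ℝ => ∫ y : sphere (0 : EuclideanSpace ℝ (Fin (k + 2))) 1,
      ∫ u, ε / (ε ^ 2 + ⟪(u : EuclideanSpace ℝ (Fin (k + 2 + 1))), L y⟫ ^ 2) * g u
        ∂(sphereMeasure (k + 2 + 1)) ∂(sphereMeasure (k + 2))) (𝓝[>] 0)
      (𝓝 (∫ y : sphere (0 : EuclideanSpace ℝ (Fin (k + 2))) 1,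
        Real.pi * Ff (L y) ∂(sphereMeasure (k + 2)))) := by
    have hLy (y : sphere (0 : EuclideanSpace ℝ (Fin (k + 2))) 1) :
        ‖L y‖ = 1 := by rw [L.norm_map, norm_eq_of_mem_sphere]
    have hne (y : sphere (0 : EuclideanSpace ℝ (Fin (k + 2))) 1) :
        L y ≠ 0 := by rw [← norm_pos_iff, hLy]; exact one_pos
    refine tendsto_integral_filter_of_dominated_convergence
      (fun _ => Real.pi * (M * (sphereMeasure (k + 2)).real univ)) ?_ ?_
      (integrable_const _) (.of_forall fun y => ?_)
    · filter_upwards [self_mem_nhdsWithin] with ε hε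
      exact (hprod hε).aestronglyMeasurable.integral_prod_right'
    · filter_upwards [self_mem_nhdsWithin] with ε hε
      refine .of_forall fun y => ?_
      obtain ⟨L', hL'⟩ := exists_linearIsometry_range_eq_orthogonal (hne y)
      exact abs_integral_toSphere_cauchy_mul_le (hLy y) (inner_eq_zero_of_range_eq hL') hdim hg
        hM hε
    · obtain ⟨L', hL'⟩ := exists_linearIsometry_range_eq_orthogonal (hne y)
      rw [hFf _ (hLy y) L' hL']
      simpa only [hg_def, sphereSlice_zero, sphereMeasure] using
        tendsto_integral_toSphere_cauchy_mul (hLy y) (inner_eq_zero_of_range_eq hL') hdim hg hM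
  have hright : Tendsto (fun ε : ℝ => ∫ y : sphere (0 : EuclideanSpace ℝ (Fin (k + 2))) 1,
      ∫ u, ε / (ε ^ 2 + ⟪(u : EuclideanSpace ℝ (Fin (k + 2 + 1))), L y⟫ ^ 2) * g u
        ∂(sphereMeasure (k + 2 + 1)) ∂(sphereMeasure (k + 2))) (𝓝[>] 0)
      (𝓝 (sphereArea k * (Real.pi * ∫ p, (g ∘ sphereSlice hv hvL) p * √(1 + p.1 ^ 2)
        ∂((sliceMeasure (k + 2)).prod (sphereMeasure (k + 2)))))) := by
    refine ((hlim.mono_left nhdsWithin_le_nhds).const_mul (sphereArea k)).congr' ?_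
    filter_upwards [self_mem_nhdsWithin] with ε hε
    have hε' : 0 < ε := hε
    rw [integral_integral_swap (hprod hε), ← integral_const_mul]
    refine Eq.symm ((integral_toSphere_eq_integral_sphereSlice hv hvL hdim
      (hprod hε).swap.aestronglyMeasurable.integral_prod_right').trans ?_)
    rw [hfin]
    refine integral_congr_ae (.of_forall fun p => ?_)
    have hR : 0 < √(1 + p.1 ^ 2) := by positivity
    have hz : ‖(p.2 : EuclideanSpace ℝ (Fin (k + 2)))‖ = 1 := norm_eq_of_mem_sphere p.2
    obtain ⟨L', hL'⟩ := exists_linearIsometry_range_eq_orthogonal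
      (norm_pos_iff.1 (hz ▸ one_pos))
    have hin := integral_toSphere_cauchy hz (inner_eq_zero_of_range_eq hL') (by simp)
      (mul_pos hε' hR)
    rw [hfin'] at hin
    simp only [Function.comp_apply, Prod.swap, inner_sphereSlice_map, cauchy_div hR,
      integral_mul_const, integral_const_mul]
    rw [sphereMeasure, hin, sphereArea, sphereMeasure, Measure.real]
    ring
  have hpi : Real.pi ≠ 0 := Real.pi_ne_zero
  have heq := tendsto_nhds_unique hleft hright
  rw [integral_const_mul, mul_left_comm] at heq
  rw [mul_left_cancel₀ hpi heq]
  congr 1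
  refine Eq.symm ((integral_toSphere_eq_integral_sphereSlice hv hvL hdim hmeas).trans ?_)
  simp only [hpull, hfin]
  rfl
end

section
/- Let n ≥ 2 and let φ be a diffeomorphism of the unit sphere S^n ⊂ ℝ^{n+1} with the property that for every n-dimensional linear subspace V ⊂ ℝ^{n+1} there exists an n-dimensional linear subspace V′ ⊂ ℝ^{n+1} with φ(V ∩ S^n) = V′ ∩ S^n (i.e. φ maps every (n−1)-equator onto an (n−1)-equator). Then there exists an invertible linear map T ∈ GL(n+1, ℝ) such that φ(x) = T x / ‖T x‖ for every x ∈ S^n. -/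
open scoped Manifold

open Module

section Subspaces

variable {K E : Type*} [Field K] [AddCommGroup E] [Module K E]

/-- A map carrying hyperplanes to subspaces carries all subspaces to
subspaces, since every subspace is an intersection of hyperplanes. -/
lemma exists_subspace_of_hyperplanes [FiniteDimensional K E] {ι : Type*} {n : ℕ}
    (hdim : finrank K E = n + 1) (i f : ι → E)
    (hf : ∀ V : Submodule K E, finrank K V = n → ∃ V' : Submodule K E,
      ∀ x, f x ∈ V' ↔ i x ∈ V) (U : Submodule K E) :
    ∃ U' : Submodule K E, ∀ x, f x ∈ U' ↔ i x ∈ U := by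
  choose V' hV' using hf
  refine ⟨⨅ (V : Submodule K E) (hV : finrank K V = n) (_ : U ≤ V), V' V hV, fun x => ?_⟩
  simp only [Submodule.mem_iInf, hV']
  refine ⟨fun h => ?_, fun h V _ hUV => hUV h⟩
  by_contra hx
  obtain ⟨l, hlx, hl⟩ := Submodule.exists_le_ker_of_notMem hx
  have hl0 : l ≠ 0 := by
    rintro rfl
    simp at hlx
  have hker := Module.Dual.finrank_ker_add_one_of_ne_zero hl0
  exact hlx (h (LinearMap.ker l) (by omega) hl)

variable {F : E → E}

/-- A surjection carrying subspaces to subspaces does not raise their dimension. -/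
lemma finrank_le_of_surjective_of_map_subspace [FiniteDimensional K E]
    (hsurj : Function.Surjective F)
    (hsub : ∀ U : Submodule K E, ∃ U' : Submodule K E, ∀ x, F x ∈ U' ↔ x ∈ U)
    (U U' : Submodule K E) (hU : ∀ x, F x ∈ U' ↔ x ∈ U) : finrank K U' ≤ finrank K U := by
  induction hd : finrank K E - finrank K U generalizing U U' with
  | zero =>
    have h1 := U.finrank_le
    have h2 := U'.finrank_le
    omega
  | succ d ih =>
    have hne : U ≠ ⊤ := by
      rintro rfl
      simp at hd
    obtain ⟨v, -, hv⟩ := SetLike.exists_of_lt hne.lt_top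
    have hW : finrank K (U ⊔ K ∙ v : Submodule K E) = finrank K U + 1 := by
      have h := Submodule.finrank_sup_add_finrank_inf_eq U (K ∙ v)
      have hdisj : U ⊓ K ∙ v = ⊥ :=
        ((Submodule.disjoint_span_singleton' (by rintro rfl; simp at hv)).2 hv).eq_bot
      rw [hdisj, finrank_bot, finrank_span_singleton (by rintro rfl; simp at hv)] at h
      omega
    obtain ⟨W', hW'⟩ := hsub (U ⊔ K ∙ v)
    have hle := ih _ W' hW' (by omega)
    have hlt : U' < W' := by
      refine SetLike.lt_iff_le_and_exists.2 ⟨fun y hy => ?_, F v, ?_, ?_⟩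
      · obtain ⟨x, rfl⟩ := hsurj y
        exact (hW' x).2 (Submodule.mem_sup_left ((hU x).1 hy))
      · exact (hW' v).2 (Submodule.mem_sup_right (Submodule.mem_span_singleton_self v))
      · rwa [hU]
    have := Submodule.finrank_lt_finrank_of_lt hlt
    omega

/-- A homogeneous injection maps independent pairs to independent pairs. -/
lemma LinearIndependent.pair_map_of_homogeneous (hinj : Function.Injective F)
    (hsmul : ∀ (t : K) x, F (t • x) = t • F x) {x y : E}
    (h : LinearIndependent K ![x, y]) : LinearIndependent K ![F x, F y] := by
  have hF0 : F 0 = 0 := by simpa using hsmul 0 0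
  have hx : x ≠ 0 := h.ne_zero 0
  rw [LinearIndependent.pair_iff' hx] at h
  rw [LinearIndependent.pair_iff' (fun h0 => hx (hinj (h0.trans hF0.symm)))]
  intro a ha
  rw [← hsmul] at ha
  exact h a (hinj ha)

/-- A homogeneous bijection carrying subspaces to subspaces maps the sum of two vectors into
the span of their images. -/
lemma map_add_mem_span_pair [FiniteDimensional K E] (hbij : Function.Bijective F)
    (hsmul : ∀ (t : K) x, F (t • x) = t • F x)
    (hsub : ∀ U : Submodule K E, ∃ U' : Submodule K E, ∀ x, F x ∈ U' ↔ x ∈ U)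
    (x y : E) : ∃ a b : K, a • F x + b • F y = F (x + y) := by
  by_cases hxy : LinearIndependent K ![x, y]
  · obtain ⟨W', hW'⟩ := hsub (Submodule.span K {x, y})
    have hle := finrank_le_of_surjective_of_map_subspace hbij.2 hsub _ W' hW'
    have hspan : Submodule.span K {F x, F y} ≤ W' := by
      rw [Submodule.span_le]
      rintro z (rfl | rfl)
      · exact (hW' x).2 (Submodule.subset_span (by simp))
      · exact (hW' y).2 (Submodule.subset_span (by simp))
    have h1 := finrank_span_eq_card hxy
    have h2 := finrank_span_eq_card (hxy.pair_map_of_homogeneous hbij.1 hsmul)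
    rw [Matrix.range_cons_cons_empty, Fintype.card_fin] at h1 h2
    have heq := Submodule.eq_of_le_of_finrank_le hspan (by omega)
    rw [← Submodule.mem_span_pair, heq, hW', Submodule.mem_span_pair]
    exact ⟨1, 1, by simp⟩
  · by_cases hx : x = 0
    · exact ⟨0, 1, by simp [hx]⟩
    · rw [LinearIndependent.pair_iff' hx] at hxy
      push Not at hxy
      obtain ⟨a, rfl⟩ := hxy
      refine ⟨1 + a, 0, ?_⟩
      rw [zero_smul, add_zero, ← hsmul, add_smul, one_smul]

end Subspaces

section Affine

variable {E : Type*} [AddCommGroup E] [Module ℝ E] {F : E → E}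

/-- A functional vanishing exactly on the image of the kernel of a given functional. -/
lemma exists_dual_of_map_subspace
    (hsmul : ∀ (t : ℝ) x, F (t • x) = t • F x)
    (hadd : ∀ x y, ∃ a b : ℝ, a • F x + b • F y = F (x + y))
    (hsub : ∀ U : Submodule ℝ E, ∃ U' : Submodule ℝ E, ∀ x, F x ∈ U' ↔ x ∈ U)
    (l : E →ₗ[ℝ] ℝ) (e : E) (he : l e = 1) :
    ∃ m : E →ₗ[ℝ] ℝ, m (F e) = 1 ∧ ∀ x, m (F x) = 0 ↔ l x = 0 := by
  obtain ⟨H', hH'⟩ := hsub (LinearMap.ker l)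
  have heH : F e ∉ H' := by simp [hH', he]
  obtain ⟨m, hme, hm⟩ := Submodule.exists_le_ker_of_notMem heH
  have hker : ∀ x, l x = 0 → m (F x) = 0 := fun x hx => hm ((hH' x).2 hx)
  refine ⟨(m (F e))⁻¹ • m, by simp [hme], fun x => ?_⟩
  simp only [LinearMap.smul_apply, smul_eq_mul, mul_eq_zero, inv_eq_zero, hme, false_or]
  refine ⟨fun hx => ?_, hker x⟩
  by_contra hlx
  obtain ⟨a, b, hab⟩ := hadd ((l x)⁻¹ • x) (e - (l x)⁻¹ • x)
  rw [add_sub_cancel, hsmul] at hab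
  apply hme
  rw [← hab, map_add, map_smul, map_smul, map_smul, hx,
    hker (e - (l x)⁻¹ • x) (by simp [he, hlx])]
  simp

/-- The expression of `F` in the affine charts `l = 1` and `m = 1`, based at `e` and `F e`. -/
noncomputable def affineChart (F : E → E) (m : E →ₗ[ℝ] ℝ) (e h : E) : E :=
  (m (F (e + h)))⁻¹ • F (e + h) - F e

variable {l m : E →ₗ[ℝ] ℝ} {e : E}

lemma affineChart_add_base (he : l e = 1) (hlm : ∀ x, m (F x) = 0 ↔ l x = 0)
    {h : E} (hh : l h = 0) :
    F (e + h) = m (F (e + h)) • (F e + affineChart F m e h) := by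
  have : m (F (e + h)) ≠ 0 := by simp [hlm, he, hh]
  simp [affineChart, smul_smul, this]

lemma dual_affineChart (he : l e = 1) (hme : m (F e) = 1)
    (hlm : ∀ x, m (F x) = 0 ↔ l x = 0) {h : E} (hh : l h = 0) :
    m (affineChart F m e h) = 0 := by
  have : m (F (e + h)) ≠ 0 := by simp [hlm, he, hh]
  simp [affineChart, hme, this]

/-- Directions in the chart are mapped as by `F`, up to scale. -/
lemma exists_smul_affineChart_eq (hsmul : ∀ (t : ℝ) x, F (t • x) = t • F x)
    (hadd : ∀ x y, ∃ a b : ℝ, a • F x + b • F y = F (x + y))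
    (he : l e = 1) (hme : m (F e) = 1)
    (hlm : ∀ x, m (F x) = 0 ↔ l x = 0) {k : E} (hk : l k = 0) :
    ∃ c : ℝ, F k = c • affineChart F m e k := by
  obtain ⟨a, b, hab⟩ := hadd (e + k) ((-1 : ℝ) • e)
  rw [show e + k + (-1 : ℝ) • e = k by module, hsmul] at hab
  have h0 := congrArg m hab
  rw [(hlm k).2 hk] at h0
  simp only [map_add, map_smul, hme, smul_eq_mul] at h0
  refine ⟨a * m (F (e + k)), ?_⟩
  have hb : b = a * m (F (e + k)) := by linarith
  have hF := affineChart_add_base he hlm hk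
  generalize m (F (e + k)) = r at hF hb ⊢
  rw [← hab, hF, hb]
  module

/-- In the chart, translates of lines are mapped to translates of lines. -/
lemma exists_affineChart_add (hsmul : ∀ (t : ℝ) x, F (t • x) = t • F x)
    (hadd : ∀ x y, ∃ a b : ℝ, a • F x + b • F y = F (x + y))
    (he : l e = 1) (hme : m (F e) = 1)
    (hlm : ∀ x, m (F x) = 0 ↔ l x = 0) {h k : E} (hh : l h = 0) (hk : l k = 0) :
    ∃ q : ℝ, affineChart F m e (h + k) = affineChart F m e h + q • affineChart F m e k := by
  obtain ⟨a, b, hab⟩ := hadd (e + h) k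
  obtain ⟨c, hc⟩ := exists_smul_affineChart_eq hsmul hadd he hme hlm hk
  have hhk : l (h + k) = 0 := by simp [hh, hk]
  have h0 : m (F (e + (h + k))) ≠ 0 := by simp [hlm, he, hh, hk]
  have h1 : m (F (e + (h + k))) = a * m (F (e + h)) := by
    rw [← add_assoc, ← hab, map_add, map_smul, map_smul, (hlm k).2 hk]
    simp
  refine ⟨(m (F (e + (h + k))))⁻¹ * (b * c), ?_⟩
  have hF : F (e + (h + k)) = m (F (e + (h + k))) • (F e + affineChart F m e h) +
      (b * c) • affineChart F m e k := by
    rw [h1, mul_smul, ← affineChart_add_base he hlm hh, mul_smul, ← hc, hab, add_assoc]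
  replace hF := (affineChart_add_base he hlm hhk).symm.trans hF
  generalize m (F (e + (h + k))) = r at h0 hF ⊢
  apply smul_right_injective E h0
  apply add_left_cancel (a := r • F e)
  simp only [smul_add, smul_smul, mul_inv_cancel_left₀ h0] at hF ⊢
  rw [hF, add_assoc]

/-- The chart expression is additive on independent pairs: parallelograms are mapped to
parallelograms. -/
lemma affineChart_add_of_linearIndependent (hinj : Function.Injective F)
    (hsmul : ∀ (t : ℝ) x, F (t • x) = t • F x)
    (hadd : ∀ x y, ∃ a b : ℝ, a • F x + b • F y = F (x + y))
    (he : l e = 1) (hme : m (F e) = 1)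
    (hlm : ∀ x, m (F x) = 0 ↔ l x = 0) {h k : E} (hh : l h = 0) (hk : l k = 0)
    (hhk : LinearIndependent ℝ ![h, k]) :
    affineChart F m e (h + k) = affineChart F m e h + affineChart F m e k := by
  obtain ⟨p, hp⟩ := exists_affineChart_add hsmul hadd he hme hlm hh hk
  obtain ⟨q, hq⟩ := exists_affineChart_add hsmul hadd he hme hlm hk hh
  obtain ⟨c, hc⟩ := exists_smul_affineChart_eq hsmul hadd he hme hlm hh
  obtain ⟨d, hd⟩ := exists_smul_affineChart_eq hsmul hadd he hme hlm hk
  have hind := hhk.pair_map_of_homogeneous hinj hsmul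
  rw [LinearIndependent.pair_iff] at hind
  have hd0 : d ≠ 0 := by
    rintro rfl
    simpa using hind 0 1 (by simp [hd])
  have hc0 : c ≠ 0 := by
    rintro rfl
    simpa using hind 1 0 (by simp [hc])
  rw [add_comm k h, hp] at hq
  have key := hind ((1 - q) / c) ((p - 1) / d) (by
    rw [hc, hd, smul_smul, smul_smul, div_mul_cancel₀ _ hc0, div_mul_cancel₀ _ hd0,
      ← sub_eq_zero.2 hq]
    module)
  have hp1 : p = 1 := by
    have := (div_eq_zero_iff.1 key.2).resolve_right hd0
    linarith
  rw [hp, hp1, one_smul]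

end Affine

section Continuous

variable {E : Type*} [NormedAddCommGroup E] [NormedSpace ℝ E] [FiniteDimensional ℝ E]
  {F : E → E} {l m : E →ₗ[ℝ] ℝ} {e : E}

lemma continuous_affineChart_comp {X : Type*} [TopologicalSpace X] (hcont : Continuous F)
    (he : l e = 1) (hlm : ∀ x, m (F x) = 0 ↔ l x = 0) {u : X → E} (hu : Continuous u)
    (hlu : ∀ t, l (u t) = 0) : Continuous fun t => affineChart F m e (u t) := by
  have hm : Continuous m := m.continuous_of_finiteDimensional
  have hFu : Continuous fun t => F (e + u t) := hcont.comp (continuous_const.add hu)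
  refine (((hm.comp hFu).inv₀ fun t => ?_).smul hFu).sub continuous_const
  simp [hlm, he, hlu]

/-- The chart expression is additive. -/
lemma affineChart_add (hdim : 3 ≤ finrank ℝ E) (hinj : Function.Injective F)
    (hcont : Continuous F) (hsmul : ∀ (t : ℝ) x, F (t • x) = t • F x)
    (hadd : ∀ x y, ∃ a b : ℝ, a • F x + b • F y = F (x + y))
    (he : l e = 1) (hme : m (F e) = 1)
    (hlm : ∀ x, m (F x) = 0 ↔ l x = 0) {h k : E} (hh : l h = 0) (hk : l k = 0) :
    affineChart F m e (h + k) = affineChart F m e h + affineChart F m e k := by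
  by_cases hhk : LinearIndependent ℝ ![h, k]
  · exact affineChart_add_of_linearIndependent hinj hsmul hadd he hme hlm hh hk hhk
  by_cases h0 : h = 0
  · simp [h0, affineChart, hme]
  obtain ⟨s, rfl⟩ : ∃ s : ℝ, s • h = k := by
    rw [LinearIndependent.pair_iff' h0] at hhk
    push Not at hhk
    exact hhk
  have hl0 : l ≠ 0 := by
    rintro rfl
    simp at he
  have hker := Module.Dual.finrank_ker_add_one_of_ne_zero hl0
  have hnle : ¬ LinearMap.ker l ≤ ℝ ∙ h := fun hle => by
    have h1 := Submodule.finrank_mono hle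
    rw [finrank_span_singleton h0] at h1
    omega
  obtain ⟨w, hw, hwh⟩ := SetLike.not_le_iff_exists.1 hnle
  have hlw : l w = 0 := hw
  have hchart : ∀ c : ℝ, Continuous fun t : ℝ => affineChart F m e (c • h + (s • h + t • w)) :=
    fun c => continuous_affineChart_comp hcont he hlm (by fun_prop) (by simp [hh, hlw])
  have heq := Continuous.ext_on (dense_compl_singleton (0 : ℝ)) (hchart 1)
    ((continuous_const (y := affineChart F m e h)).add (hchart 0)) (fun t ht => by
      simp only [one_smul, zero_smul, zero_add]
      refine affineChart_add_of_linearIndependent hinj hsmul hadd he hme hlm hh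
        (by simp [hh, hlw]) ((LinearIndependent.pair_iff' h0).2 fun a ha => hwh ?_)
      refine Submodule.mem_span_singleton.2 ⟨t⁻¹ * (a - s), ?_⟩
      rw [mul_smul, sub_smul, ha, add_sub_cancel_left, inv_smul_smul₀ ht])
  simpa using congrFun heq 0

/-- The chart factor of `F` is positive, by connectedness. -/
lemma dual_map_add_pos (hcont : Continuous F) (he : l e = 1) (hme : m (F e) = 1)
    (hlm : ∀ x, m (F x) = 0 ↔ l x = 0) {h : E} (hh : l h = 0) : 0 < m (F (e + h)) := by
  have hm : Continuous m := m.continuous_of_finiteDimensional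
  by_contra hneg
  have hc : Continuous fun t : ℝ => m (F (e + t • h)) := by fun_prop
  obtain ⟨t, ht⟩ := mem_range_of_exists_le_of_exists_ge hc
    ⟨1, by simpa using not_lt.1 hneg⟩ ⟨0, by simp [hme]⟩
  simp [hlm, he, hh] at ht

/-- A form of the **fundamental theorem of projective geometry**: a homogeneous continuous
bijection carrying subspaces to subspaces is, up to positive factors, linear. -/
theorem exists_linearEquiv_of_map_subspace (hdim : 3 ≤ finrank ℝ E)
    (hbij : Function.Bijective F) (hcont : Continuous F)
    (hsmul : ∀ (t : ℝ) x, F (t • x) = t • F x)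
    (hsub : ∀ U : Submodule ℝ E, ∃ U' : Submodule ℝ E, ∀ x, F x ∈ U' ↔ x ∈ U) :
    ∃ T : E ≃ₗ[ℝ] E, ∀ x, ‖T x‖ • F x = ‖F x‖ • T x := by
  have hadd := map_add_mem_span_pair hbij hsmul hsub
  have hF0 : F 0 = 0 := by simpa using hsmul 0 0
  have : Nontrivial E := nontrivial_of_finrank_pos (R := ℝ) (by omega)
  obtain ⟨e, he0⟩ := exists_ne (0 : E)
  obtain ⟨l, he⟩ := Module.Projective.exists_dual_eq_one ℝ he0
  obtain ⟨m, hme, hlm⟩ := exists_dual_of_map_subspace hsmul hadd hsub l e he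
  let g : LinearMap.ker l →+ E := AddMonoidHom.mk' (fun h => affineChart F m e h)
    fun h k => affineChart_add hdim hbij.1 hcont hsmul hadd he hme hlm h.2 k.2
  let G := g.toRealLinearMap
    (continuous_affineChart_comp hcont he hlm continuous_subtype_val fun h => h.2)
  let π : E →ₗ[ℝ] LinearMap.ker l :=
    (LinearMap.id - l.smulRight e).codRestrict _ fun x => by simp [he]
  let T : E →ₗ[ℝ] E := l.smulRight (F e) + G.toLinearMap ∘ₗ π
  have hTa : ∀ h, l h = 0 → T (e + h) = F e + affineChart F m e h := fun h hh => by
    change l (e + h) • F e + affineChart F m e (e + h - l (e + h) • e) = _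
    simp [he, hh]
  have hTF : ∀ h, l h = 0 → ∃ c : ℝ, 0 < c ∧ F (e + h) = c • T (e + h) := fun h hh =>
    ⟨_, dual_map_add_pos hcont he hme hlm hh, by
      rw [hTa h hh]
      exact affineChart_add_base he hlm hh⟩
  have hTF' : ∀ x, l x ≠ 0 → ∃ c : ℝ, 0 < c ∧ F x = c • T x := fun x hx => by
    obtain ⟨c, hc, h⟩ := hTF ((l x)⁻¹ • x - e) (by simp [he, hx])
    refine ⟨c, hc, ?_⟩
    rw [add_sub_cancel, hsmul, map_smul, smul_comm] at h
    exact smul_right_injective E (inv_ne_zero hx) h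
  have hinj : Function.Injective T := by
    rw [injective_iff_map_eq_zero]
    intro x hx
    by_cases hlx : l x = 0
    · obtain ⟨c, -, h⟩ := hTF x hlx
      obtain ⟨d, hd, h'⟩ := hTF 0 (map_zero l)
      rw [map_add, hx] at h
      rw [add_zero] at h h'
      have hex : e + x = (c / d) • e := hbij.1 (by
        rw [h, hsmul, h', smul_smul, div_mul_cancel₀ _ hd.ne'])
      have hcd : 1 = c / d := by simpa [he, hlx] using congrArg l hex
      rw [← hcd, one_smul] at hex
      exact left_eq_add.1 hex.symm
    · obtain ⟨c, -, h⟩ := hTF' x hlx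
      rw [hx, smul_zero, ← hF0] at h
      exact hbij.1 h
  have hT : Continuous T := T.continuous_of_finiteDimensional
  refine ⟨LinearEquiv.ofInjectiveEndo T hinj, fun x => ?_⟩
  change ‖T x‖ • F x = ‖F x‖ • T x
  have heq := Continuous.ext_on (dense_compl_singleton (-l x))
    (f := fun t : ℝ => ‖T (x + t • e)‖ • F (x + t • e))
    (g := fun t : ℝ => ‖F (x + t • e)‖ • T (x + t • e)) (by fun_prop) (by fun_prop)
    (fun t ht => by
      obtain ⟨c, hc, h⟩ := hTF' (x + t • e) (by
        simp only [map_add, map_smul, he, smul_eq_mul, mul_one]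
        exact fun h0 => ht (by simp only [Set.mem_singleton_iff]; linarith))
      simp only [h, norm_smul, Real.norm_of_nonneg hc.le, smul_smul]
      rw [mul_comm])
  simpa using congrFun heq 0

end Continuous

section Sphere

variable {E : Type*} [NormedAddCommGroup E] [NormedSpace ℝ E]

open Metric

/-- The positively homogeneous extension of a self-map of the unit sphere. -/
noncomputable def radialExtension (f : sphere (0 : E) 1 → sphere (0 : E) 1) (x : E) : E :=
  open scoped Classical in
  if h : x = 0 then 0 else ‖x‖ • (f ⟨‖x‖⁻¹ • x, by simp [norm_smul, h]⟩ : E)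

variable {f : sphere (0 : E) 1 → sphere (0 : E) 1}

lemma radialExtension_zero : radialExtension f 0 = 0 := by simp [radialExtension]

lemma radialExtension_smul_coe (p : sphere (0 : E) 1) {r : ℝ} (hr : 0 ≤ r) :
    radialExtension f (r • (p : E)) = r • (f p : E) := by
  obtain rfl | hr := hr.eq_or_lt
  · simp [radialExtension_zero]
  have hne : r • (p : E) ≠ 0 := smul_ne_zero hr.ne' (ne_zero_of_mem_unit_sphere p)
  have hn : ‖r • (p : E)‖ = r := by simp [norm_smul, abs_of_pos hr]
  rw [radialExtension, dif_neg hne]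
  congr 3
  ext1
  simp [norm_smul, abs_of_pos hr, smul_smul, hr.ne']

lemma exists_eq_norm_smul_coe {x : E} (hx : x ≠ 0) :
    ∃ p : sphere (0 : E) 1, x = ‖x‖ • (p : E) :=
  ⟨⟨‖x‖⁻¹ • x, by simp [norm_smul, hx]⟩, by simp [smul_smul, hx]⟩

lemma norm_radialExtension (x : E) : ‖radialExtension f x‖ = ‖x‖ := by
  by_cases hx : x = 0
  · simp [hx, radialExtension_zero]
  · obtain ⟨p, hp⟩ := exists_eq_norm_smul_coe hx
    rw [hp, radialExtension_smul_coe p (norm_nonneg x)]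
    simp [norm_smul]

lemma radialExtension_injective (hf : Function.Injective f) :
    Function.Injective (radialExtension f) := by
  intro x y hxy
  have hn : ‖x‖ = ‖y‖ := by rw [← norm_radialExtension (f := f) x, hxy, norm_radialExtension]
  by_cases hx : x = 0
  · rw [hx, norm_zero] at hn
    rw [hx, norm_eq_zero.1 hn.symm]
  · have hy : y ≠ 0 := by
      rintro rfl
      simp [hx] at hn
    obtain ⟨p, hp⟩ := exists_eq_norm_smul_coe hx
    obtain ⟨q, hq⟩ := exists_eq_norm_smul_coe hy
    rw [hp, hq, ← hn, radialExtension_smul_coe p (norm_nonneg x),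
      radialExtension_smul_coe q (norm_nonneg x)] at hxy
    have := hf (Subtype.ext (smul_right_injective E (norm_ne_zero_iff.2 hx) hxy))
    rw [hp, hq, ← hn, this]

lemma radialExtension_surjective (hf : Function.Surjective f) :
    Function.Surjective (radialExtension f) := by
  intro y
  by_cases hy : y = 0
  · exact ⟨0, by rw [hy, radialExtension_zero]⟩
  · obtain ⟨q, hq⟩ := exists_eq_norm_smul_coe hy
    obtain ⟨p, rfl⟩ := hf q
    exact ⟨‖y‖ • (p : E), by rw [radialExtension_smul_coe p (norm_nonneg y), ← hq]⟩

lemma continuous_radialExtension (hf : Continuous f) : Continuous (radialExtension f) := by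
  rw [continuous_iff_continuousAt]
  intro x
  by_cases hx : x = 0
  · rw [hx, ContinuousAt, radialExtension_zero]
    refine squeeze_zero_norm (fun y => (norm_radialExtension y).le) ?_
    simpa using (continuous_norm (E := E)).tendsto 0
  · have hopen : IsOpen ({0}ᶜ : Set E) := isOpen_compl_singleton
    refine ContinuousOn.continuousAt (s := {0}ᶜ) ?_ (hopen.mem_nhds hx)
    rw [continuousOn_iff_continuous_domRestrict]
    have hP := (homeomorphUnitSphereProd E).continuous
    have hc : Continuous fun y : ({0}ᶜ : Set E) =>
        ‖(y : E)‖ • (f (homeomorphUnitSphereProd E y).1 : E) := by fun_prop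
    refine hc.congr fun y => ?_
    rw [Set.domRestrict_apply, ← radialExtension_smul_coe _ (norm_nonneg _)]
    congr 1
    have hy : (y : E) ≠ 0 := y.2
    simp [smul_smul, hy]

lemma radialExtension_smul (hf : ∀ p, f (-p) = -f p) (t : ℝ) (x : E) :
    radialExtension f (t • x) = t • radialExtension f x := by
  by_cases hx : x = 0
  · simp [hx, radialExtension_zero]
  obtain ⟨p, hp⟩ := exists_eq_norm_smul_coe hx
  rw [hp, radialExtension_smul_coe p (norm_nonneg x), smul_smul, smul_smul]
  rcases le_total 0 (t * ‖x‖) with h | h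
  · exact radialExtension_smul_coe p h
  · have := radialExtension_smul_coe (f := f) (-p) (neg_nonneg.2 h)
    simpa [hf] using this

lemma radialExtension_mem_iff {U U' : Submodule ℝ E} (h : ∀ p, (f p : E) ∈ U' ↔ (p : E) ∈ U)
    (x : E) : radialExtension f x ∈ U' ↔ x ∈ U := by
  by_cases hx : x = 0
  · simp [hx, radialExtension_zero]
  obtain ⟨p, hp⟩ := exists_eq_norm_smul_coe hx
  have hn : ‖x‖ ≠ 0 := norm_ne_zero_iff.2 hx
  rw [hp, radialExtension_smul_coe p (norm_nonneg x), U'.smul_mem_iff hn, U.smul_mem_iff hn, h]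

/-- A bijection of the sphere carrying subspace sections to subspace sections is odd. -/
lemma map_neg_of_map_subspace (hf : Function.Bijective f)
    (hsub : ∀ U : Submodule ℝ E, ∃ U' : Submodule ℝ E, ∀ p, (f p : E) ∈ U' ↔ (p : E) ∈ U)
    (p : sphere (0 : E) 1) : f (-p) = -f p := by
  obtain ⟨U', hU'⟩ := hsub (ℝ ∙ (p : E))
  obtain ⟨q, hq⟩ := hf.2 (-f p)
  have hmem : (f q : E) ∈ U' := by
    rw [hq, coe_neg_sphere, neg_mem_iff, hU']
    exact Submodule.mem_span_singleton_self _
  obtain ⟨a, ha⟩ := Submodule.mem_span_singleton.1 ((hU' q).1 hmem)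
  have habs : |a| = 1 := by
    have := congrArg norm ha
    simpa [norm_smul] using this
  rcases eq_or_eq_neg_of_abs_eq habs with rfl | rfl
  · have hpq : p = q := Subtype.ext (by simpa using ha)
    rw [← hpq] at hq
    have h2 : (f p : E) = -(f p : E) := congrArg Subtype.val hq
    have : IsAddTorsionFree E := .of_isTorsionFree ℝ E
    exact absurd (self_eq_neg.1 h2) (ne_zero_of_mem_unit_sphere _)
  · have hpq : -p = q := Subtype.ext (by simpa using ha)
    rw [hpq, hq]

end Sphere

/-- Proposition 9.3 of the paper. A diffeomorphism `φ` of the unit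
sphere `S^n ⊂ ℝ^{n+1}` mapping every `(n−1)`-equator (the intersection of `S^n` with an
`n`-dimensional linear subspace) onto an `(n−1)`-equator is induced by an invertible
linear map: `φ(x) = Tx/‖Tx‖` for some `T ∈ GL(n+1,ℝ)`. -/
theorem equator_preserving_diffeo_is_projective_linear
    (n : ℕ) (hn : 2 ≤ n)
    [Fact (Module.finrank ℝ (EuclideanSpace ℝ (Fin (n + 1))) = n + 1)]
    (φ : Diffeomorph (𝓡 n) (𝓡 n)
      (Metric.sphere (0 : EuclideanSpace ℝ (Fin (n + 1))) 1)
      (Metric.sphere (0 : EuclideanSpace ℝ (Fin (n + 1))) 1) (⊤ : ℕ∞))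
    (hφ : ∀ V : Submodule ℝ (EuclideanSpace ℝ (Fin (n + 1))), Module.finrank ℝ V = n →
      ∃ V' : Submodule ℝ (EuclideanSpace ℝ (Fin (n + 1))), Module.finrank ℝ V' = n ∧
        φ '' {p : Metric.sphere (0 : EuclideanSpace ℝ (Fin (n + 1))) 1 |
            (p : EuclideanSpace ℝ (Fin (n + 1))) ∈ V} =
          {q : Metric.sphere (0 : EuclideanSpace ℝ (Fin (n + 1))) 1 |
            (q : EuclideanSpace ℝ (Fin (n + 1))) ∈ V'}) :
    ∃ T : EuclideanSpace ℝ (Fin (n + 1)) ≃ₗ[ℝ] EuclideanSpace ℝ (Fin (n + 1)),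
      ∀ p : Metric.sphere (0 : EuclideanSpace ℝ (Fin (n + 1))) 1,
        (φ p : EuclideanSpace ℝ (Fin (n + 1))) =
          ‖T (p : EuclideanSpace ℝ (Fin (n + 1)))‖⁻¹ •
            T (p : EuclideanSpace ℝ (Fin (n + 1))) := by
  have hdim : finrank ℝ (EuclideanSpace ℝ (Fin (n + 1))) = n + 1 := Fact.out
  have hbij : Function.Bijective φ := φ.bijective
  have hsub := exists_subspace_of_hyperplanes hdim Subtype.val (fun p => (φ p).val)
    fun V hV => by
      obtain ⟨V', -, h⟩ := hφ V hV
      refine ⟨V', fun p => ?_⟩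
      have hp := Set.ext_iff.1 h (φ p)
      rw [hbij.1.mem_set_image] at hp
      exact hp.symm
  have hodd := map_neg_of_map_subspace hbij hsub
  obtain ⟨T, hT⟩ := exists_linearEquiv_of_map_subspace (by omega)
    ⟨radialExtension_injective hbij.1, radialExtension_surjective hbij.2⟩
    (continuous_radialExtension φ.continuous) (radialExtension_smul hodd)
    fun U => (hsub U).imp fun U' h => radialExtension_mem_iff h
  refine ⟨T, fun p => ?_⟩
  have hp := hT p
  have hφp : radialExtension φ (p : EuclideanSpace ℝ (Fin (n + 1))) = φ p := by
    simpa using radialExtension_smul_coe (f := φ) p zero_le_one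
  have hTp : ‖T p‖ ≠ 0 := by
    simpa using ne_zero_of_mem_unit_sphere p
  rw [hφp, norm_eq_of_mem_sphere, one_smul] at hp
  rw [← hp, norm_smul, norm_norm, norm_eq_of_mem_sphere, mul_one, inv_smul_smul₀ hTp]
end

section
/- Let n ≥ 2 and let X̃ : ℝ^{n+1} → ℝ^{n+1} be a continuously differentiable map with ⟨X̃(x), x⟩ = 0 for every x ∈ S^n (a tangent vector field of S^n). Fix a unit vector v ∈ ℝ^{n+1}. For x ∈ Σ_v, let div_{Σ_v}X̃(x) = Σ_{i=1}^{n−1} ⟨DX̃(x)[e_i], e_i⟩, where (e₁, …, e_{n−1}) is any orthonormal basis of the subspace {x,v}^⊥ ⊂ ℝ^{n+1} (the value is independent of the choice of basis). Then ∫_{Σ_v} div_{Σ_v}X̃ dσ_v = 0. -/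
open MeasureTheory
open scoped RealInnerProductSpace

section SphereDivergence

open Metric Set Module

variable {E : Type*} [NormedAddCommGroup E] [InnerProductSpace ℝ E]

/-- The derivative of the norm away from the origin. -/
theorem hasFDerivAt_norm_of_ne_zero {y : E} (hy : y ≠ 0) :
    HasFDerivAt (fun z : E => ‖z‖) (‖y‖⁻¹ • innerSL ℝ y) y := by
  have hy' : ‖y‖ ≠ 0 := norm_ne_zero_iff.2 hy
  have h := (hasStrictFDerivAt_norm_sq y).hasFDerivAt.sqrt (pow_ne_zero 2 hy')
  simp only [Real.sqrt_sq (norm_nonneg _)] at h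
  convert! h using 1
  ext w
  simp
  field_simp

/-- The derivative of the radial projection onto the unit sphere. -/
theorem hasFDerivAt_norm_inv_smul {y : E} (hy : y ≠ 0) :
    HasFDerivAt (fun z : E => ‖z‖⁻¹ • z)
      (‖y‖⁻¹ • ContinuousLinearMap.id ℝ E -
        (‖y‖ ^ 3)⁻¹ • InnerProductSpace.rankOne ℝ y y) y := by
  have hy' : ‖y‖ ≠ 0 := norm_ne_zero_iff.2 hy
  have h := ((hasDerivAt_inv hy').comp_hasFDerivAt y (hasFDerivAt_norm_of_ne_zero hy)).smul
    (hasFDerivAt_id y)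
  convert! h using 1
  ext w
  simp [sub_eq_add_neg, smul_smul]
  congr 1
  field_simp

section

variable [FiniteDimensional ℝ E]

/-- The divergence of a vector field extended from the unit sphere radially with profile `q`,
when the field is tangent to the sphere. -/
theorem trace_fderiv_radial_smul {Y : E → E} (hY : Differentiable ℝ Y)
    (hYtan : ∀ y, ‖y‖ = 1 → ⟪Y y, y⟫ = 0) {q : ℝ → ℝ} {y : E} (hy : y ≠ 0)
    (hq : DifferentiableAt ℝ q ‖y‖) :
    LinearMap.trace ℝ E (fderiv ℝ (fun z => q ‖z‖ • Y (‖z‖⁻¹ • z)) y).toLinearMap =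
      q ‖y‖ * ‖y‖⁻¹ * (LinearMap.trace ℝ E (fderiv ℝ Y (‖y‖⁻¹ • y)).toLinearMap -
        ⟪fderiv ℝ Y (‖y‖⁻¹ • y) (‖y‖⁻¹ • y), ‖y‖⁻¹ • y⟫) := by
  have hy' : ‖y‖ ≠ 0 := norm_ne_zero_iff.2 hy
  set A := fderiv ℝ Y (‖y‖⁻¹ • y) with hA
  have hYπ := (hY (‖y‖⁻¹ • y)).hasFDerivAt.comp (f := fun z => ‖z‖⁻¹ • z) y
    (hasFDerivAt_norm_inv_smul hy)
  have hqn := hq.hasDerivAt.comp_hasFDerivAt y (hasFDerivAt_norm_of_ne_zero hy)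
  have hZ : HasFDerivAt (fun z => q ‖z‖ • Y (‖z‖⁻¹ • z))
      ((q ‖y‖ * ‖y‖⁻¹) • A - (q ‖y‖ * (‖y‖ ^ 3)⁻¹) • InnerProductSpace.rankOne ℝ (A y) y +
        (deriv q ‖y‖ * ‖y‖⁻¹) • InnerProductSpace.rankOne ℝ (Y (‖y‖⁻¹ • y)) y) y := by
    convert! hqn.smul hYπ using 1
    ext w
    simp [smul_smul, smul_sub, mul_assoc, hA]
  have htan : ⟪y, Y (‖y‖⁻¹ • y)⟫ = 0 := by
    have h := hYtan (‖y‖⁻¹ • y) (by rw [norm_smul, norm_inv, norm_norm, inv_mul_cancel₀ hy'])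
    rw [real_inner_smul_right, real_inner_comm] at h
    exact (mul_eq_zero.1 h).resolve_left (inv_ne_zero hy')
  rw [hZ.fderiv]
  simp only [ContinuousLinearMap.toLinearMap_add, ContinuousLinearMap.toLinearMap_sub,
    ContinuousLinearMap.toLinearMap_smul, map_add, map_sub, map_smul,
    InnerProductSpace.trace_rankOne, htan, smul_eq_mul, mul_zero, add_zero]
  rw [real_inner_smul_right, real_inner_smul_left, real_inner_comm y (A y)]
  field_simp

variable [MeasurableSpace E] [BorelSpace E] (μ : Measure E) [μ.IsAddHaarMeasure]

/-- The divergence of a compactly supported `C¹` vector field has vanishing integral. -/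
theorem integral_trace_fderiv_eq_zero {Z : E → E} (hZ : ContDiff ℝ 1 Z)
    (hZc : HasCompactSupport Z) :
    ∫ y, LinearMap.trace ℝ E (fderiv ℝ Z y).toLinearMap ∂μ = 0 := by
  let b := stdOrthonormalBasis ℝ E
  have hint (i) : Integrable (fun y => ⟪b i, fderiv ℝ Z y (b i)⟫) μ := by
    refine Continuous.integrable_of_hasCompactSupport ?_ ?_
    · have := hZ.continuous_fderiv one_ne_zero
      fun_prop
    · exact (hZc.fderiv ℝ).comp_left (g := fun T : E →L[ℝ] E => ⟪b i, T (b i)⟫) (by simp)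
  have hint' (i) : Integrable (fun y => ⟪b i, Z y⟫) μ := by
    refine Continuous.integrable_of_hasCompactSupport ?_ ?_
    · have := hZ.continuous
      fun_prop
    · exact hZc.comp_left (g := fun z : E => ⟪b i, z⟫) (by simp)
  simp_rw [LinearMap.trace_eq_sum_inner _ b, ContinuousLinearMap.coe_coe]
  rw [integral_finsetSum _ fun i _ => hint i]
  refine Finset.sum_eq_zero fun i _ => ?_
  have h := integral_bilinear_hasFDerivAt_right_eq_neg_left_of_integrable (μ := μ) (v := b i)
    (B := innerSL ℝ) (f := fun _ : E => b i) (f' := fun _ => 0) (g := Z) (g' := fderiv ℝ Z)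
    (by simp) (hint i) (hint' i)
    (fun x _ => hasFDerivAt_const _ _)
    (fun x _ => (hZ.differentiable one_ne_zero x).hasFDerivAt)
  refine h.trans ?_
  simp

/-- Integration in polar coordinates of a product of a radial and an angular function. -/
theorem integral_mul_angular_eq [Nontrivial E] (p : ℝ → ℝ) (f : E → ℝ) :
    ∫ y, f (‖y‖⁻¹ • y) * p ‖y‖ ∂μ =
      (∫ u : sphere (0 : E) 1, f u ∂μ.toSphere) *
        ∫ r : Ioi (0 : ℝ), p r ∂Measure.volumeIoiPow (finrank ℝ E - 1) :=
  calc
    ∫ y, f (‖y‖⁻¹ • y) * p ‖y‖ ∂μ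
      = ∫ y : ({0}ᶜ : Set E), f (‖y.1‖⁻¹ • y.1) * p ‖y.1‖ ∂(μ.comap (↑)) := by
      rw [integral_subtype_comap (measurableSet_singleton _).compl
        fun y => f (‖y‖⁻¹ • y) * p ‖y‖, restrict_compl_singleton]
    _ = ∫ x : sphere (0 : E) 1 × Ioi (0 : ℝ), f x.1 * p x.2
          ∂μ.toSphere.prod (.volumeIoiPow (finrank ℝ E - 1)) := by
      simpa using μ.measurePreserving_homeomorphUnitSphereProd.integral_comp
        (Homeomorph.measurableEmbedding _)
        (fun x : sphere (0 : E) 1 × Ioi (0 : ℝ) => f x.1 * p x.2)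
    _ = _ := integral_prod_mul (fun u : sphere (0 : E) 1 => f u) fun r : Ioi (0 : ℝ) => p r

/-- The divergence theorem on the unit sphere: the tangential divergence of a `C¹` tangent
vector field has vanishing integral. -/
theorem integral_sphere_tangential_divergence_eq_zero [Nontrivial E] {Y : E → E}
    (hY : ContDiff ℝ 1 Y) (hYtan : ∀ y, ‖y‖ = 1 → ⟪Y y, y⟫ = 0) :
    ∫ u : sphere (0 : E) 1, (LinearMap.trace ℝ E (fderiv ℝ Y u).toLinearMap -
      ⟪fderiv ℝ Y u u, (u : E)⟫) ∂μ.toSphere = 0 := by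
  let p : ContDiffBump (2 : ℝ) := ⟨1 / 2, 1, by norm_num, by norm_num⟩
  have hp_zero (r : ℝ) (hr : 1 ≤ |r - 2|) : p r = 0 :=
    p.zero_of_le_dist (by simpa [Real.dist_eq, p] using hr)
  let Z : E → E := fun y => (p ‖y‖ * ‖y‖) • Y (‖y‖⁻¹ • y)
  have hZ : ContDiff ℝ 1 Z := by
    refine contDiff_iff_contDiffAt.2 fun y => ?_
    by_cases hy : y = 0
    · refine (contDiffAt_const (c := (0 : E))).congr_of_eventuallyEq ?_
      filter_upwards [ball_mem_nhds y one_pos] with z hz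
      have hz : ‖z‖ < 1 := by simpa [hy] using hz
      have : p ‖z‖ = 0 := hp_zero _ (by rw [abs_sub_comm]; exact le_abs.2 (by left; linarith))
      simp [Z, this]
    · have hn : ContDiffAt ℝ 1 (fun z : E => ‖z‖) y := contDiffAt_norm ℝ hy
      exact ((p.contDiffAt.comp y hn).mul hn).smul
        (hY.contDiffAt.comp y ((hn.inv (norm_ne_zero_iff.2 hy)).smul contDiffAt_id))
  have hp_large (y : E) (hy : y ∉ closedBall (0 : E) 3) : p ‖y‖ = 0 := by
    have hy : 3 < ‖y‖ := by simpa using hy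
    exact hp_zero _ (le_abs.2 (by left; linarith))
  have hZc : HasCompactSupport Z :=
    HasCompactSupport.intro (isCompact_closedBall 0 3) fun y hy => by simp [Z, hp_large y hy]
  have hpos : 0 < ∫ y : E, p ‖y‖ ∂μ := by
    obtain ⟨y, hy⟩ := exists_norm_eq E (zero_le_two (α := ℝ))
    refine (p.continuous.comp continuous_norm).integral_pos_of_hasCompactSupport_nonneg_nonzero
      (HasCompactSupport.intro (isCompact_closedBall 0 3) hp_large) (fun _ => p.nonneg) (x := y) ?_
    simp only [hy]
    exact (p.pos_of_mem_ball (by simp [p])).ne'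
  have hradial := integral_mul_angular_eq μ p (fun _ : E => 1)
  simp only [one_mul] at hradial
  have hdiv := integral_mul_angular_eq μ p fun u : E =>
    LinearMap.trace ℝ E (fderiv ℝ Y u).toLinearMap - ⟪fderiv ℝ Y u u, u⟫
  have hzero := integral_trace_fderiv_eq_zero μ hZ hZc
  rw [integral_congr_ae (g := fun y => (LinearMap.trace ℝ E
    (fderiv ℝ Y (‖y‖⁻¹ • y)).toLinearMap - ⟪fderiv ℝ Y (‖y‖⁻¹ • y) (‖y‖⁻¹ • y), ‖y‖⁻¹ • y⟫) *
      p ‖y‖), hdiv] at hzero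
  · refine (mul_eq_zero.1 hzero).resolve_right fun h => ?_
    rw [hradial, h, mul_zero] at hpos
    exact hpos.false
  · filter_upwards [μ.ae_ne 0] with y hy
    have hd : DifferentiableAt ℝ (fun r => p r * r) ‖y‖ :=
      (p.contDiff.differentiable one_ne_zero _).mul differentiableAt_id
    rw [trace_fderiv_radial_smul (hY.differentiable one_ne_zero) hYtan (q := fun r => p r * r)
      hy hd, mul_inv_cancel_right₀ (norm_ne_zero_iff.2 hy), mul_comm]

end

/-- A unit vector of `ℝ^(m+1)` is the zeroth member of an orthonormal basis. -/
theorem exists_orthonormalBasis_zero_eq {m : ℕ} {y : EuclideanSpace ℝ (Fin (m + 1))}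
    (hy : ‖y‖ = 1) :
    ∃ b : OrthonormalBasis (Fin (m + 1)) ℝ (EuclideanSpace ℝ (Fin (m + 1))), b 0 = y := by
  have ho : Orthonormal ℝ (({0} : Set (Fin (m + 1))).domRestrict fun _ => y) :=
    ⟨fun _ => hy, fun i j hij => (hij (Subsingleton.elim i j)).elim⟩
  obtain ⟨b, hb⟩ := ho.exists_orthonormalBasis_extension_of_card_eq (by simp)
  exact ⟨b, hb 0 rfl⟩

/-- If the zeroth vector of an orthonormal basis is mapped to `x` by an isometry onto `v^⊥`,
the images of the other basis vectors span `{x, v}^⊥`. -/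
theorem span_range_isometry_succ_eq {F : Type*} [NormedAddCommGroup F] [InnerProductSpace ℝ F]
    {m : ℕ} (b : OrthonormalBasis (Fin (m + 1)) ℝ E) (L : E →ₗᵢ[ℝ] F) {v : F}
    (hL : LinearMap.range L.toLinearMap = (Submodule.span ℝ {v})ᗮ) :
    Submodule.span ℝ (range fun i : Fin m => L (b i.succ)) =
      (Submodule.span ℝ {L (b 0), v})ᗮ := by
  have hLv (w : E) : ⟪v, L w⟫ = 0 := by
    have : L w ∈ (Submodule.span ℝ {v})ᗮ := hL ▸ ⟨w, rfl⟩
    exact Submodule.mem_orthogonal_singleton_iff_inner_right.1 this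
  have hmem (z : F) : z ∈ (Submodule.span ℝ {L (b 0), v})ᗮ ↔ ⟪L (b 0), z⟫ = 0 ∧ ⟪v, z⟫ = 0 := by
    rw [Submodule.span_insert, ← Submodule.inf_orthogonal, Submodule.mem_inf,
      Submodule.mem_orthogonal_singleton_iff_inner_right,
      Submodule.mem_orthogonal_singleton_iff_inner_right]
  apply le_antisymm
  · rw [Submodule.span_le]
    rintro _ ⟨i, rfl⟩
    refine (hmem _).2 ⟨?_, hLv _⟩
    rw [L.inner_map_map]
    exact b.orthonormal.2 (Fin.succ_ne_zero i).symm
  · intro z hz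
    obtain ⟨hz0, hzv⟩ := (hmem z).1 hz
    obtain ⟨w, rfl⟩ : z ∈ LinearMap.range L.toLinearMap :=
      hL ▸ Submodule.mem_orthogonal_singleton_iff_inner_right.2 hzv
    change L w ∈ _
    replace hz0 : ⟪b 0, w⟫ = 0 := by rw [← L.inner_map_map]; exact hz0
    rw [← b.sum_repr' w, Fin.sum_univ_succ, hz0, zero_smul, zero_add, map_sum]
    refine Submodule.sum_mem _ fun i _ => ?_
    rw [map_smul]
    exact Submodule.smul_mem _ _ (Submodule.subset_span ⟨i, rfl⟩)

end SphereDivergence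

/-- Claim 1 in the proof of Proposition 9.4 of the paper.
For a `C¹` tangent vector field `X̃` of `S^n` and a unit vector `v`, the tangential
divergence of `X̃` along the equator `Σ_v` — the function `D` with
`D(x) = Σᵢ ⟨DX̃(x)[eᵢ], eᵢ⟩` for any orthonormal basis `(eᵢ)` of `{x,v}^⊥` —
has vanishing integral over `Σ_v`. Integration over `Σ_v` is realized through any
linear isometry `L` of `ℝ^n` onto the hyperplane `v^⊥`. -/
theorem equator_divergence_theorem
    (n : ℕ) (hn : 2 ≤ n)
    (Xt : EuclideanSpace ℝ (Fin (n + 1)) → EuclideanSpace ℝ (Fin (n + 1)))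
    (hXt : ContDiff ℝ 1 Xt)
    (hXtan : ∀ x : EuclideanSpace ℝ (Fin (n + 1)), ‖x‖ = 1 → ⟪Xt x, x⟫ = 0)
    (v : EuclideanSpace ℝ (Fin (n + 1))) (hv : ‖v‖ = 1)
    (D : EuclideanSpace ℝ (Fin (n + 1)) → ℝ)
    (hD : ∀ x : EuclideanSpace ℝ (Fin (n + 1)), ‖x‖ = 1 → ⟪x, v⟫ = 0 →
      ∀ e : Fin (n - 1) → EuclideanSpace ℝ (Fin (n + 1)), Orthonormal ℝ e →
        Submodule.span ℝ (Set.range e) = (Submodule.span ℝ {x, v})ᗮ →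
        D x = ∑ i : Fin (n - 1), ⟪fderiv ℝ Xt x (e i), e i⟫)
    (L : EuclideanSpace ℝ (Fin n) →ₗᵢ[ℝ] EuclideanSpace ℝ (Fin (n + 1)))
    (hL : LinearMap.range L.toLinearMap = (Submodule.span ℝ {v})ᗮ) :
    (∫ y : Metric.sphere (0 : EuclideanSpace ℝ (Fin n)) 1,
        D (L ↑y) ∂(sphereMeasure n)) = 0 := by
  obtain ⟨m, rfl⟩ : ∃ m, n = m + 1 := ⟨n - 1, by omega⟩
  let Y : EuclideanSpace ℝ (Fin (m + 1)) → EuclideanSpace ℝ (Fin (m + 1)) := fun y =>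
    L.toContinuousLinearMap.adjoint (Xt (L y))
  have hY : ContDiff ℝ 1 Y :=
    L.toContinuousLinearMap.adjoint.contDiff.comp (hXt.comp L.toContinuousLinearMap.contDiff)
  have hYtan (y) (hy : ‖y‖ = 1) : ⟪Y y, y⟫ = 0 := by
    simpa [Y, ContinuousLinearMap.adjoint_inner_left] using hXtan (L y) (by simpa using hy)
  have hYderiv (y w) : ⟪w, fderiv ℝ Y y w⟫ = ⟪fderiv ℝ Xt (L y) (L w), L w⟫ := by
    have h : HasFDerivAt Y (L.toContinuousLinearMap.adjoint ∘L
        (fderiv ℝ Xt (L y) ∘L L.toContinuousLinearMap)) y :=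
      L.toContinuousLinearMap.adjoint.hasFDerivAt.comp y
        ((hXt.differentiable one_ne_zero (L y)).hasFDerivAt.comp y
          L.toContinuousLinearMap.hasFDerivAt)
    rw [h.fderiv]
    simp [ContinuousLinearMap.adjoint_inner_right, real_inner_comm]
  rw [← integral_sphere_tangential_divergence_eq_zero volume hY hYtan]
  refine integral_congr_ae (.of_forall fun y => ?_)
  have hy : ‖(y : EuclideanSpace ℝ (Fin (m + 1)))‖ = 1 := by simp
  obtain ⟨b, hb⟩ := exists_orthonormalBasis_zero_eq hy
  have hLy : ⟪L y, v⟫ = 0 := by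
    have : L y ∈ (Submodule.span ℝ {v})ᗮ := hL ▸ ⟨(y : EuclideanSpace ℝ (Fin (m + 1))), rfl⟩
    exact Submodule.mem_orthogonal_singleton_iff_inner_left.1 this
  have hDy := hD (L y) (by simp) hLy (fun i : Fin m => L (b i.succ))
    ((b.orthonormal.comp_linearIsometry L).comp Fin.succ (Fin.succ_injective m))
    (by rw [← hb]; exact span_range_isometry_succ_eq b L hL)
  beta_reduce
  rw [hDy, LinearMap.trace_eq_sum_inner _ b, Fin.sum_univ_succ, hb, ContinuousLinearMap.coe_coe,
    real_inner_comm (y : EuclideanSpace ℝ (Fin (m + 1))), add_sub_cancel_left]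
  exact Finset.sum_congr rfl fun i _ => (hYderiv _ _).symm
end

section
/- For a, b ∈ {i, j, k} ⊂ ℍ, let T_{a,b} : ℍ → ℍ be the ℝ-linear map T_{a,b}(x) = a·x·b. Then each T_{a,b} is self-adjoint with respect to the real inner product ⟨x,y⟩ = Re(x·conj(y)) on ℍ and has trace zero, and the nine maps T_{a,b} (a, b ∈ {i,j,k}) form a basis of the 9-dimensional real vector space of self-adjoint, trace-free ℝ-linear endomorphisms of ℍ. -/
open scoped RealInnerProductSpace Quaternion

/-- The basic quaternion `i`. -/
noncomputable def qi : Quaternion ℝ := ⟨0, 1, 0, 0⟩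

/-- The basic quaternion `j`. -/
noncomputable def qj : Quaternion ℝ := ⟨0, 0, 1, 0⟩

/-- The basic quaternion `k`. -/
noncomputable def qk : Quaternion ℝ := ⟨0, 0, 0, 1⟩

/-- The family of the three basic quaternions `i, j, k`. -/
noncomputable def basicQ : Fin 3 → Quaternion ℝ := ![qi, qj, qk]

/-- The ℝ-linear map `T_{a,b} : x ↦ a·x·b` on the quaternions. -/
noncomputable def Tq (a b : Quaternion ℝ) : Quaternion ℝ →ₗ[ℝ] Quaternion ℝ :=
  (LinearMap.mulRight ℝ b).comp (LinearMap.mulLeft ℝ a)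

/-- The nine maps `T_{a,b}`, `a, b ∈ {i,j,k}`, indexed by `Fin 3 × Fin 3`. -/
noncomputable def TqFam : Fin 3 × Fin 3 → (Quaternion ℝ →ₗ[ℝ] Quaternion ℝ) :=
  fun q => Tq (basicQ q.1) (basicQ q.2)

@[simp]
theorem qi_components : qi.re = 0 ∧ qi.imI = 1 ∧ qi.imJ = 0 ∧ qi.imK = 0 :=
  ⟨rfl, rfl, rfl, rfl⟩

@[simp]
theorem qj_components : qj.re = 0 ∧ qj.imI = 0 ∧ qj.imJ = 1 ∧ qj.imK = 0 :=
  ⟨rfl, rfl, rfl, rfl⟩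

@[simp]
theorem qk_components : qk.re = 0 ∧ qk.imI = 0 ∧ qk.imJ = 0 ∧ qk.imK = 1 :=
  ⟨rfl, rfl, rfl, rfl⟩

namespace Quaternion

/-- Two real-linear endomorphisms of `ℍ` agreeing on `1, i, j, k` are equal. -/
theorem linearMap_ext_basic {A B : ℍ[ℝ] →ₗ[ℝ] ℍ[ℝ]} (h1 : A 1 = B 1) (hi : A qi = B qi)
    (hj : A qj = B qj) (hk : A qk = B qk) : A = B := by
  ext1 x
  have hx : x = x.re • (1 : ℍ[ℝ]) + x.imI • qi + x.imJ • qj + x.imK • qk := by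
    ext <;> simp
  rw [hx]
  simp only [map_add, map_smul, h1, hi, hj, hk]

theorem trace_eq_sum_basic (A : ℍ[ℝ] →ₗ[ℝ] ℍ[ℝ]) :
    LinearMap.trace ℝ ℍ[ℝ] A = (A 1).re + (A qi).imI + (A qj).imJ + (A qk).imK := by
  let b : Module.Basis (Fin 4) ℝ ℍ[ℝ] := QuaternionAlgebra.basisOneIJK (-1) 0 (-1)
  have hrepr (q : ℍ[ℝ]) : b.repr q = ![q.re, q.imI, q.imJ, q.imK] :=
    QuaternionAlgebra.coe_basisOneIJK_repr (-1) 0 (-1) q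
  have hb (n : Fin 4) : b n = ![1, qi, qj, qk] n := by
    apply b.repr.injective
    apply DFunLike.coe_injective
    rw [b.repr_self, hrepr]
    funext m
    fin_cases n <;> fin_cases m <;> simp
  rw [LinearMap.trace_eq_matrix_trace ℝ b, Matrix.trace, Fin.sum_univ_four]
  simp [LinearMap.toMatrix_apply, hrepr, hb]

theorem inner_eq_sum (x y : ℍ[ℝ]) :
    ⟪x, y⟫ = x.re * y.re + x.imI * y.imI + x.imJ * y.imJ + x.imK * y.imK := by
  simp [inner_def]

end Quaternion

open Quaternion

theorem Tq_apply (a b x : ℍ[ℝ]) : Tq a b x = a * x * b := rfl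

theorem trace_Tq (a b : ℍ[ℝ]) : LinearMap.trace ℝ ℍ[ℝ] (Tq a b) = 4 * (a.re * b.re) := by
  simp [trace_eq_sum_basic, Tq_apply]
  ring

theorem inner_Tq_left {a b : ℍ[ℝ]} (ha : a.re = 0) (hb : b.re = 0) (x y : ℍ[ℝ]) :
    ⟪Tq a b x, y⟫ = ⟪x, Tq a b y⟫ := by
  simp [inner_eq_sum, Tq_apply, ha, hb]
  ring

theorem re_basicQ (n : Fin 3) : (basicQ n).re = 0 := by
  fin_cases n <;> simp [basicQ]

theorem linearIndependent_TqFam : LinearIndependent ℝ TqFam := by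
  rw [Fintype.linearIndependent_iff]
  intro c hc
  have h1 := LinearMap.congr_fun hc 1
  have hi := LinearMap.congr_fun hc qi
  have hj := LinearMap.congr_fun hc qj
  have hk := LinearMap.congr_fun hc qk
  simp [Fintype.sum_prod_type, Fin.sum_univ_three, TqFam, Tq_apply, basicQ,
    Quaternion.ext_iff] at h1 hi hj hk
  obtain ⟨_, _, _, _⟩ := h1
  obtain ⟨_, _, _, _⟩ := hi
  obtain ⟨_, _, _, _⟩ := hj
  obtain ⟨_, _, _, _⟩ := hk
  rintro ⟨m, n⟩
  fin_cases m <;> fin_cases n <;> simp <;> linarith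

/-- The coefficient of `T_{a,b}` in the orthogonal expansion of an endomorphism. -/
noncomputable def TqCoeff (A : ℍ[ℝ] →ₗ[ℝ] ℍ[ℝ]) (a b : ℍ[ℝ]) : ℝ :=
  (⟪A 1, Tq a b 1⟫ + ⟪A qi, Tq a b qi⟫ + ⟪A qj, Tq a b qj⟫ + ⟪A qk, Tq a b qk⟫) / 4

theorem sum_TqCoeff_smul_TqFam {A : ℍ[ℝ] →ₗ[ℝ] ℍ[ℝ]} (hA : ∀ x y : ℍ[ℝ], ⟪A x, y⟫ = ⟪x, A y⟫)
    (htr : LinearMap.trace ℝ ℍ[ℝ] A = 0) :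
    ∑ q, TqCoeff A (basicQ q.1) (basicQ q.2) • TqFam q = A := by
  rw [trace_eq_sum_basic] at htr
  have h1i := hA 1 qi
  have h1j := hA 1 qj
  have h1k := hA 1 qk
  have hij := hA qi qj
  have hik := hA qi qk
  have hjk := hA qj qk
  simp [inner_eq_sum] at h1i h1j h1k hij hik hjk
  simp only [Fintype.sum_prod_type, Fin.sum_univ_three, TqFam, TqCoeff, inner_eq_sum, Tq_apply]
  simp [basicQ]
  apply linearMap_ext_basic <;> ext <;> simp [Tq_apply] <;> linarith

/-- final step of the proof of Theorem D of the paper. Each map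
`T_{a,b}(x) = a·x·b` (`a, b ∈ {i,j,k}`) is self-adjoint for the real inner product
`⟨x,y⟩ = Re(x·conj y)` on `ℍ` and trace-free, and the nine maps `T_{a,b}` form a basis
of the 9-dimensional real vector space of self-adjoint trace-free ℝ-linear
endomorphisms of `ℍ`. -/
theorem quaternion_Tab_basis :
    (∀ a ∈ ({qi, qj, qk} : Set (Quaternion ℝ)), ∀ b ∈ ({qi, qj, qk} : Set (Quaternion ℝ)),
      (∀ x y : Quaternion ℝ, ⟪Tq a b x, y⟫ = ⟪x, Tq a b y⟫) ∧
        LinearMap.trace ℝ (Quaternion ℝ) (Tq a b) = 0) ∧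
    LinearIndependent ℝ TqFam ∧
    (Submodule.span ℝ (Set.range TqFam) : Set (Quaternion ℝ →ₗ[ℝ] Quaternion ℝ)) =
      {A : Quaternion ℝ →ₗ[ℝ] Quaternion ℝ |
        (∀ x y : Quaternion ℝ, ⟪A x, y⟫ = ⟪x, A y⟫) ∧
          LinearMap.trace ℝ (Quaternion ℝ) A = 0} ∧
    Module.finrank ℝ (Submodule.span ℝ (Set.range TqFam)) = 9 := by
  have hre : ∀ a ∈ ({qi, qj, qk} : Set ℍ[ℝ]), a.re = 0 := by
    rintro a (rfl | rfl | rfl) <;> rfl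
  refine ⟨fun a ha b hb => ⟨inner_Tq_left (hre a ha) (hre b hb), ?_⟩, linearIndependent_TqFam,
    ?_, ?_⟩
  · rw [trace_Tq, hre a ha, zero_mul, mul_zero]
  · ext A
    simp only [SetLike.mem_coe, Set.mem_ofPred_eq]
    constructor
    · intro hA
      induction hA using Submodule.span_induction with
      | mem A hA =>
        obtain ⟨q, rfl⟩ := hA
        exact ⟨inner_Tq_left (re_basicQ _) (re_basicQ _), by simp [TqFam, trace_Tq, re_basicQ]⟩
      | zero => simp
      | add A B _ _ hA hB =>
        exact ⟨fun x y => by simp [inner_add_left, inner_add_right, hA.1 x y, hB.1 x y],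
          by rw [map_add, hA.2, hB.2, add_zero]⟩
      | smul r A _ hA =>
        exact ⟨fun x y => by simp [real_inner_smul_left, real_inner_smul_right, hA.1 x y],
          by rw [map_smul, hA.2, smul_zero]⟩
    · rintro ⟨hA, htr⟩
      rw [← sum_TqCoeff_smul_TqFam hA htr]
      exact Submodule.sum_mem _ fun q _ =>
        Submodule.smul_mem _ _ (Submodule.subset_span ⟨q, rfl⟩)
  · simp [finrank_span_eq_card linearIndependent_TqFam]
end
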